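/- arXiv:2502.05839 — 7 statements merged into one kernel-verified Lean document; each statement's English description precedes it below -/
import Mathlib

section
/- Assume μ₊ ≤ 0 and μ₋ > 0, and set a₁ := 2·ln(θ₁⁻/θ₂⁻)/(θ₂⁻ + θ₁⁻) and b := min(a, a₁) (so b = a when 0 < a ≤ a₁ and b = a₁ when a > a₁). Define ι_b(u) := inf{z ∈ [0,b] : g'(z) ≤ u} and φ_b(x) := ψ(ι_b(g'(x)), x) for x ≥ b. Then there exists a unique z₂ ∈ (b,∞) with φ_b(z₂) = β, and M_ζ = {(ι_b(g'(z₂)), z₂)}. -/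
open Real Set Filter

/-- If `h` is strictly decreasing on `[0,b]` and strictly increasing on `[b,∞)`, then for `w ≥ b`
the point `sInf {z ∈ [0,b] | h z ≤ h w}` lies in `[0,b]` and is the left endpoint of the region of
`[0,∞)` where `h < h w`, whose right endpoint is `w`. -/
theorem sInf_sublevel_spec {h : ℝ → ℝ} {b w : ℝ} (hb : 0 < b) (hc : Continuous h)
    (hanti : StrictAntiOn h (Icc 0 b)) (hmono : StrictMonoOn h (Ici b)) (hw : b ≤ w) :
    sInf {z : ℝ | z ∈ Icc 0 b ∧ h z ≤ h w} ∈ Icc 0 b ∧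
      (∀ s, 0 ≤ s → s < sInf {z : ℝ | z ∈ Icc 0 b ∧ h z ≤ h w} → h w < h s) ∧
      (∀ s, sInf {z : ℝ | z ∈ Icc 0 b ∧ h z ≤ h w} < s → s < w → h s < h w) := by
  set S := {z : ℝ | z ∈ Icc 0 b ∧ h z ≤ h w} with hS
  have hbS : b ∈ S := ⟨⟨hb.le, le_rfl⟩, hmono.monotoneOn (mem_Ici.2 le_rfl) (mem_Ici.2 hw) hw⟩
  have hbdd : BddBelow S := ⟨0, fun z hz => hz.1.1⟩
  have hcl : IsClosed S := isClosed_Icc.inter (isClosed_le hc continuous_const)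
  have hmem : sInf S ∈ S := hcl.csInf_mem ⟨b, hbS⟩ hbdd
  refine ⟨hmem.1, fun s hs hsι => ?_, fun s hsι hsw => ?_⟩
  · by_contra! hcon
    exact absurd (csInf_le hbdd ⟨⟨hs, hsι.le.trans hmem.1.2⟩, hcon⟩) (not_le.2 hsι)
  · rcases le_total s b with hsb | hbs
    · exact (hanti hmem.1 ⟨hmem.1.1.trans hsι.le, hsb⟩ hsι).trans_le hmem.2
    · exact hmono (mem_Ici.2 hbs) (mem_Ici.2 hw) hsw

/-- If `k` decreases strictly on `[0,i]`, increases strictly on `[i,w]` and decreases strictly on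
`[w,∞)`, then `(i,w)` is the unique maximizer of the increment `k y - k x` over `0 ≤ x < y`,
provided `i < w`. -/
theorem increment_le_of_anti_mono_anti {k : ℝ → ℝ} {i w : ℝ} (hi : 0 ≤ i) (hiw : i < w)
    (h₁ : StrictAntiOn k (Icc 0 i)) (h₂ : StrictMonoOn k (Icc i w)) (h₃ : StrictAntiOn k (Ici w))
    {x y : ℝ} (hx : 0 ≤ x) (hxy : x < y) :
    k y - k x ≤ k w - k i ∧ (k y - k x = k w - k i → x = i ∧ y = w) := by
  have hpos : k i < k w := h₂ ⟨le_rfl, hiw.le⟩ ⟨hiw.le, le_rfl⟩ hiw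
  rcases le_or_gt y i with hyi | hiy
  · have := h₁ ⟨hx, hxy.le.trans hyi⟩ ⟨hx.trans hxy.le, hyi⟩ hxy
    exact ⟨by linarith, fun h => by linarith⟩
  rcases lt_or_ge w x with hwx | hxw
  · have := h₃ (mem_Ici.2 hwx.le) (mem_Ici.2 (hwx.trans hxy).le) hxy
    exact ⟨by linarith, fun h => by linarith⟩
  have hy : k y ≤ k w ∧ (k y = k w → y = w) := by
    rcases lt_trichotomy y w with hyw | hyw | hyw
    · have := h₂ ⟨hiy.le, hyw.le⟩ ⟨hiw.le, le_rfl⟩ hyw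
      exact ⟨this.le, fun h => by linarith⟩
    · subst hyw
      exact ⟨le_rfl, fun _ => rfl⟩
    · have := h₃ (mem_Ici.2 le_rfl) (mem_Ici.2 hyw.le) hyw
      exact ⟨this.le, fun h => by linarith⟩
  have hx : k i ≤ k x ∧ (k x = k i → x = i) := by
    rcases lt_trichotomy x i with hxi | hxi | hxi
    · have := h₁ ⟨hx, hxi.le⟩ ⟨hi, le_rfl⟩ hxi
      exact ⟨this.le, fun h => by linarith⟩
    · subst hxi
      exact ⟨le_rfl, fun _ => rfl⟩
    · have := h₂ ⟨le_rfl, hiw.le⟩ ⟨hxi.le, hxw⟩ hxi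
      exact ⟨this.le, fun h => by linarith⟩
  exact ⟨by linarith [hx.1, hy.1],
    fun h => ⟨hx.2 (by linarith [hx.1, hy.1]), hy.2 (by linarith [hx.1, hy.1])⟩⟩

/-- The interval between the two endpoints of the region where `h < h w` is the unique maximizer
of `(y - x) * h w - (g y - g x)` over `0 ≤ x < y`. -/
theorem increment_le_of_valley {g h : ℝ → ℝ} {b w x y : ℝ} (hb : 0 < b)
    (hd : ∀ x, HasDerivAt g (h x) x) (hc : Continuous h)
    (hanti : StrictAntiOn h (Icc 0 b)) (hmono : StrictMonoOn h (Ici b)) (hw : b < w)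
    (hx : 0 ≤ x) (hxy : x < y) :
    let i := sInf {z : ℝ | z ∈ Icc 0 b ∧ h z ≤ h w}
    (y - x) * h w - (g y - g x) ≤ (w - i) * h w - (g w - g i) ∧
      ((y - x) * h w - (g y - g x) = (w - i) * h w - (g w - g i) → x = i ∧ y = w) := by
  intro i
  obtain ⟨hi, hlt, hgt⟩ := sInf_sublevel_spec hb hc hanti hmono hw.le
  change i ∈ _ at hi
  change ∀ s, 0 ≤ s → s < i → _ at hlt
  change ∀ s, i < s → _ at hgt
  have hk : ∀ s, HasDerivAt (fun s => s * h w - g s) (h w - h s) s := fun s =>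
    (hasDerivAt_mul_const (h w)).sub (hd s)
  have hkc : Continuous fun s => s * h w - g s :=
    continuous_iff_continuousAt.2 fun s => (hk s).continuousAt
  have key := increment_le_of_anti_mono_anti (k := fun s => s * h w - g s) hi.1
    (hi.2.trans_lt hw)
    (strictAntiOn_of_deriv_neg (convex_Icc 0 i) hkc.continuousOn fun s hs => by
      rw [interior_Icc] at hs
      rw [(hk s).deriv]
      linarith [hlt s hs.1.le hs.2])
    (strictMonoOn_of_deriv_pos (convex_Icc i w) hkc.continuousOn fun s hs => by
      rw [interior_Icc] at hs
      rw [(hk s).deriv]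
      linarith [hgt s hs.1 hs.2])
    (strictAntiOn_of_deriv_neg (convex_Ici w) hkc.continuousOn fun s hs => by
      rw [interior_Ici] at hs
      rw [(hk s).deriv]
      linarith [hmono (mem_Ici.2 hw.le) (mem_Ici.2 (hw.le.trans (le_of_lt hs))) hs])
    hx hxy
  exact ⟨by linarith [key.1], fun h => key.2 (by linarith)⟩

/-- Existence and uniqueness of the maximizer of `(y - x - β) / (g y - g x)` for a function `g` with
positive derivative `h` which decreases on `[0,b]` and increases to `∞` on `[b,∞)`. -/
theorem existsUnique_maximizer_of_valley {g h : ℝ → ℝ} {b β : ℝ} (hb : 0 < b) (hβ : 0 < β)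
    (hd : ∀ x, HasDerivAt g (h x) x) (hc : Continuous h) (hpos : ∀ x, 0 < h x)
    (hanti : StrictAntiOn h (Icc 0 b)) (hmono : StrictMonoOn h (Ici b))
    (htop : Tendsto h atTop atTop) {ι φ : ℝ → ℝ}
    (hι : ∀ u, ι u = sInf {z : ℝ | z ∈ Icc 0 b ∧ h z ≤ u})
    (hφ : ∀ x, φ x = (x - ι (h x)) - (g x - g (ι (h x))) / h x) :
    ∃ z₂ : ℝ, b < z₂ ∧ φ z₂ = β ∧ (∀ w : ℝ, b < w → φ w = β → w = z₂) ∧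
      {p : ℝ × ℝ | (0 ≤ p.1 ∧ 0 ≤ p.2 ∧ p.1 + β ≤ p.2) ∧
        ∀ p' : ℝ × ℝ, (0 ≤ p'.1 ∧ 0 ≤ p'.2 ∧ p'.1 + β ≤ p'.2) →
          (p'.2 - p'.1 - β) / (g p'.2 - g p'.1) ≤ (p.2 - p.1 - β) / (g p.2 - g p.1)} =
        {(ι (h z₂), z₂)} := by
  have hgc : Continuous g := continuous_iff_continuousAt.2 fun s => (hd s).continuousAt
  have hgm : StrictMono g := strictMono_of_deriv_pos fun x => by rw [(hd x).deriv]; exact hpos x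
  have hιmem : ∀ w, b ≤ w → ι (h w) ∈ Icc 0 b := fun w hw => by
    rw [hι]; exact (sInf_sublevel_spec hb hc hanti hmono hw).1
  have hφmul : ∀ w, φ w * h w = (w - ι (h w)) * h w - (g w - g (ι (h w))) := fun w => by
    rw [hφ, sub_mul, div_mul_cancel₀ _ (hpos w).ne']
  have hmax : ∀ w x y, b < w → 0 ≤ x → x < y →
      (y - x) * h w - (g y - g x) ≤ φ w * h w ∧
        ((y - x) * h w - (g y - g x) = φ w * h w → x = ι (h w) ∧ y = w) := by
    intro w x y hw hx hxy
    rw [hφmul, hι]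
    exact increment_le_of_valley hb hd hc hanti hmono hw hx hxy
  have hφmono : ∀ w w', b < w → w < w' → φ w < φ w' := by
    intro w w' hw hww'
    have hi := hιmem w hw.le
    have h1 := (hmax w' _ w (hw.trans hww') hi.1 (hi.2.trans_lt hw)).1
    have h2 := hφmul w
    have h3 : h w < h w' := hmono (mem_Ici.2 hw.le) (mem_Ici.2 (hw.trans hww').le) hww'
    have h4 : g (ι (h w)) < g w := hgm (hi.2.trans_lt hw)
    have hw0 := hpos w
    have hw0' := hpos w'
    have h5 : φ w < (w - ι (h w)) - (g w - g (ι (h w))) / h w' := by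
      rw [hφ]
      have := div_lt_div_of_pos_left (sub_pos.2 h4) hw0 h3
      linarith
    refine h5.trans_le ?_
    rw [← mul_le_mul_iff_left₀ hw0', sub_mul, div_mul_cancel₀ _ hw0'.ne']
    exact h1
  have hιb : ι (h b) = b := by
    have h1 := sInf_sublevel_spec hb hc hanti hmono le_rfl
    rw [← hι] at h1
    refine le_antisymm h1.1.2 (le_of_not_gt fun hlt => ?_)
    obtain ⟨s, hs1, hs2⟩ := exists_between hlt
    have h3 := h1.2.2 s hs1 hs2
    have h4 := hanti ⟨h1.1.1.trans hs1.le, hs2.le⟩ ⟨hb.le, le_rfl⟩ hs2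
    linarith
  have hφb : φ b = 0 := by rw [hφ, hιb]; simp
  have hφsup : ∀ w ∈ Ici b,
      φ w = sSup ((fun z => (w - z) - (g w - g z) / h w) '' Icc 0 b) := by
    intro w hw
    suffices hG : IsGreatest ((fun z => (w - z) - (g w - g z) / h w) '' Icc 0 b) (φ w) from
      hG.csSup_eq.symm
    refine ⟨⟨ι (h w), hιmem w hw, (hφ w).symm⟩, ?_⟩
    rintro _ ⟨z, hz, rfl⟩
    have hw0 := hpos w
    rw [← mul_le_mul_iff_left₀ hw0, sub_mul, div_mul_cancel₀ _ hw0.ne']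
    rcases eq_or_lt_of_le (mem_Ici.1 hw) with rfl | hbw
    · rw [hφb, zero_mul]
      have hk : ∀ s, HasDerivAt (fun s => s * h b - g s) (h b - h s) s := fun s =>
        (hasDerivAt_mul_const (h b)).sub (hd s)
      have hA : AntitoneOn (fun s => s * h b - g s) (Icc 0 b) :=
        antitoneOn_of_deriv_nonpos (convex_Icc 0 b)
          (fun s _ => (hk s).continuousAt.continuousWithinAt)
          (fun s _ => (hk s).differentiableAt.differentiableWithinAt) fun s hs => by
            rw [interior_Icc] at hs
            rw [(hk s).deriv]
            linarith [hanti ⟨hs.1.le, hs.2.le⟩ ⟨hb.le, le_rfl⟩ hs.2]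
      have := hA hz ⟨hb.le, le_rfl⟩ hz.2
      simp only at this
      linarith
    · exact (hmax w z w hbw hz.1 (hz.2.trans_lt hbw)).1
  have hφc : ContinuousOn φ (Ici b) := by
    have hcont : Continuous
        fun w => sSup ((fun z => (w - z) - (g w - g z) / h w) '' Icc 0 b) := by
      refine isCompact_Icc.continuous_sSup
        (f := fun w z => (w - z) - (g w - g z) / h w) ?_
      have : Continuous fun p : ℝ × ℝ => (p.1 - p.2) - (g p.1 - g p.2) / h p.1 :=
        (continuous_fst.sub continuous_snd).sub
          (((hgc.comp continuous_fst).sub (hgc.comp continuous_snd)).div₀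
            (hc.comp continuous_fst) fun p => (hpos _).ne')
      exact this
    exact hcont.continuousOn.congr hφsup
  obtain ⟨X, hX1, hX2⟩ : ∃ X, b < X ∧ β ≤ φ X := by
    set T := b + 2 * β with hT
    have hbT : b < T := by linarith
    obtain ⟨X, hXh, hXT⟩ :=
      ((htop.eventually_ge_atTop (2 * h T)).and (eventually_gt_atTop T)).exists
    refine ⟨X, hbT.trans hXT, ?_⟩
    have h1 := (hmax X b T (hbT.trans hXT) hb.le hbT).1
    obtain ⟨c, hc1, hc2⟩ := exists_hasDerivAt_eq_slope g h hbT hgc.continuousOn fun x _ => hd x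
    have hcT : h c < h T := hmono (mem_Ici.2 hc1.1.le) (mem_Ici.2 hbT.le) hc1.2
    rw [eq_div_iff (by linarith)] at hc2
    rw [← mul_le_mul_iff_left₀ (hpos X)]
    have hTb : T - b = 2 * β := by rw [hT]; ring
    rw [hTb] at hc2 h1
    nlinarith
  obtain ⟨z, hz, hzβ⟩ := intermediate_value_Icc hX1.le
    (hφc.mono Icc_subset_Ici_self) (show β ∈ Icc (φ b) (φ X) from ⟨by rw [hφb]; exact hβ.le, hX2⟩)
  have hbz : b < z := lt_of_le_of_ne hz.1 (by rintro rfl; linarith)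
  refine ⟨z, hbz, hzβ, fun w hw hwβ => ?_, ?_⟩
  · rcases lt_trichotomy w z with h1 | h1 | h1
    · linarith [hφmono w z hw h1]
    · exact h1
    · linarith [hφmono z w hbz h1]
  have hi := hιmem z hbz.le
  have hiz : ι (h z) < z := hi.2.trans_lt hbz
  have hval : (z - ι (h z) - β) / (g z - g (ι (h z))) = 1 / h z := by
    rw [div_eq_div_iff (sub_pos.2 (hgm hiz)).ne' (hpos z).ne']
    linarith [hφmul z, congrArg (· * h z) hzβ]
  have hle : ∀ x y, 0 ≤ x → x + β ≤ y → (y - x - β) / (g y - g x) ≤ 1 / h z ∧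
      ((y - x - β) / (g y - g x) = 1 / h z → x = ι (h z) ∧ y = z) := by
    intro x y hx hxy
    have hlt : x < y := by linarith
    have key := hmax z x y hbz hx hlt
    rw [hzβ] at key
    have hg := sub_pos.2 (hgm hlt)
    rw [div_le_div_iff₀ hg (hpos z), div_eq_div_iff hg.ne' (hpos z).ne']
    exact ⟨by linarith [key.1], fun h => key.2 (by linarith)⟩
  ext ⟨x, y⟩
  simp only [mem_ofPred_eq, mem_singleton_iff, Prod.mk.injEq]
  have hD : ι (h z) + β ≤ z := by
    have := hφ z
    have h2 := div_pos (sub_pos.2 (hgm hiz)) (hpos z)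
    linarith
  constructor
  · rintro ⟨⟨hx, -, hxy⟩, hm⟩
    have h1 := hm (ι (h z), z) ⟨hi.1, hi.1.trans hiz.le, hD⟩
    simp only [hval] at h1
    have h2 := hle x y hx hxy
    exact h2.2 (le_antisymm h2.1 h1)
  · rintro ⟨rfl, rfl⟩
    refine ⟨⟨hi.1, hi.1.trans hiz.le, hD⟩, fun p hp => ?_⟩
    rw [hval]
    exact (hle p.1 p.2 hp.1 hp.2.2).1

theorem hasDerivAt_exp_add_exp (p r q s a x : ℝ) :
    HasDerivAt (fun x => p * exp (r * (x - a)) + q * exp (-s * (x - a)))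
      (p * r * exp (r * (x - a)) + -(q * s) * exp (-s * (x - a))) x := by
  have h : ∀ r : ℝ, HasDerivAt (fun x => exp (r * (x - a))) (exp (r * (x - a)) * r) x := fun r => by
    simpa using (((hasDerivAt_id x).sub_const a).const_mul r).exp
  exact (((h r).const_mul p).add ((h (-s)).const_mul q)).congr_deriv (by ring)

/-- Two differentiable functions which agree to first order at `a` glue to a differentiable one. -/
theorem hasDerivAt_ite_lt {f₁ f₂ f₁' f₂' : ℝ → ℝ} {a : ℝ} (h₁ : ∀ x, HasDerivAt f₁ (f₁' x) x)
    (h₂ : ∀ x, HasDerivAt f₂ (f₂' x) x) (h : f₁ a = f₂ a) (h' : f₁' a = f₂' a) (x : ℝ) :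
    HasDerivAt (fun x => if a < x then f₂ x else f₁ x) (if a < x then f₂' x else f₁' x) x := by
  rcases lt_trichotomy x a with hx | rfl | hx
  · rw [if_neg hx.not_gt]
    refine (h₁ x).congr_of_eventuallyEq ?_
    filter_upwards [Iio_mem_nhds hx] with y hy
    exact if_neg (not_lt.2 (le_of_lt hy))
  · rw [if_neg (lt_irrefl x)]
    rw [← hasDerivWithinAt_univ, ← Iic_union_Ici (a := x)]
    refine HasDerivWithinAt.union ?_ ?_
    · refine (h₁ x).hasDerivWithinAt.congr (fun y hy => if_neg (not_lt.2 hy)) (by simp)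
    · rw [h']
      refine (h₂ x).hasDerivWithinAt.congr (fun y hy => ?_) (by simp [h])
      rcases eq_or_lt_of_le (mem_Ici.1 hy) with rfl | hy
      · simp [h]
      · exact if_pos hy
  · rw [if_pos hx]
    refine (h₂ x).congr_of_eventuallyEq ?_
    filter_upwards [Ioi_mem_nhds hx] with y hy
    exact if_pos hy

theorem statement12
    (a q μp μm σp σm : ℝ)
    (ha : 0 < a) (hq : 0 < q) (hσp : 0 < σp) (hσm : 0 < σm)
    (θ1p θ2p θ1m θ2m cm cp : ℝ)
    (hθ1p : θ1p = (Real.sqrt (μp ^ 2 + 2 * q * σp ^ 2) + μp) / σp ^ 2)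
    (hθ2p : θ2p = (Real.sqrt (μp ^ 2 + 2 * q * σp ^ 2) - μp) / σp ^ 2)
    (hθ1m : θ1m = (Real.sqrt (μm ^ 2 + 2 * q * σm ^ 2) + μm) / σm ^ 2)
    (hθ2m : θ2m = (Real.sqrt (μm ^ 2 + 2 * q * σm ^ 2) - μm) / σm ^ 2)
    (hcm : cm = (θ1m - θ1p) / (θ2m + θ1m))
    (hcp : cp = (θ2p - θ2m) / (θ2p + θ1p))
    (gm gp g : ℝ → ℝ)
    (hgm : ∀ x, gm x = if a < x then Real.exp (-θ1p * (x - a))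
      else cm * Real.exp (θ2m * (x - a)) + (1 - cm) * Real.exp (-θ1m * (x - a)))
    (hgp : ∀ x, gp x = if a < x then (1 - cp) * Real.exp (θ2p * (x - a)) + cp * Real.exp (-θ1p * (x - a))
      else Real.exp (θ2m * (x - a)))
    (hg : ∀ x, g x = gp x * gm 0 - gm x * gp 0)
    (β : ℝ) (hβ : 0 < β)
    (Dζ : Set (ℝ × ℝ))
    (hD : Dζ = {p : ℝ × ℝ | 0 ≤ p.1 ∧ 0 ≤ p.2 ∧ p.1 + β ≤ p.2})
    (ζ : ℝ → ℝ → ℝ)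
    (hζ : ∀ z₁ z₂, ζ z₁ z₂ = (z₂ - z₁ - β) / (g z₂ - g z₁))
    (Mζ : Set (ℝ × ℝ))
    (hM : Mζ = {p ∈ Dζ | ∀ p' ∈ Dζ, ζ p'.1 p'.2 ≤ ζ p.1 p.2})
    (ψ : ℝ → ℝ → ℝ)
    (hψ : ∀ x y, ψ x y = ∫ s in x..y, (1 - deriv g s / deriv g y))
    (hμp : μp ≤ 0) (hμm : 0 < μm)
    (a₁ : ℝ)
    (ha₁ : a₁ = 2 * Real.log (θ1m / θ2m) / (θ2m + θ1m))
    (b : ℝ) (hb : b = min a a₁)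
    (ι : ℝ → ℝ)
    (hι : ∀ u, ι u = sInf {z : ℝ | z ∈ Set.Icc 0 b ∧ deriv g z ≤ u})
    (φ : ℝ → ℝ)
    (hφ : ∀ x, φ x = ψ (ι (deriv g x)) x)
    :
    ∃ z₂ : ℝ, b < z₂ ∧ φ z₂ = β ∧ (∀ w : ℝ, b < w → φ w = β → w = z₂) ∧
      Mζ = {(ι (deriv g z₂), z₂)} := by
  have hsqrt : ∀ μ σ : ℝ, 0 < σ → |μ| < √(μ ^ 2 + 2 * q * σ ^ 2) := fun μ σ hσ => by
    rw [← Real.sqrt_sq_eq_abs]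
    exact Real.sqrt_lt_sqrt (sq_nonneg _) (by have := mul_pos hq (pow_pos hσ 2); linarith)
  have hp := abs_lt.1 (hsqrt μp σp hσp)
  have hm := abs_lt.1 (hsqrt μm σm hσm)
  have hσp2 : 0 < σp ^ 2 := pow_pos hσp 2
  have hσm2 : 0 < σm ^ 2 := pow_pos hσm 2
  have t1 : 0 < θ1p := by rw [hθ1p]; exact div_pos (by linarith) hσp2
  have t2 : 0 < θ2p := by rw [hθ2p]; exact div_pos (by linarith) hσp2
  have T1 : 0 < θ1m := by rw [hθ1m]; exact div_pos (by linarith) hσm2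
  have T2 : 0 < θ2m := by rw [hθ2m]; exact div_pos (by linarith) hσm2
  have ht : θ1p ≤ θ2p := by rw [hθ1p, hθ2p]; gcongr; linarith
  have hT : θ2m < θ1m := by rw [hθ1m, hθ2m]; gcongr; linarith
  clear hθ1p hθ2p hθ1m hθ2m hp hm hsqrt hμp hμm
  have hcm' : cm * (θ2m + θ1m) = θ1m - θ1p := by rw [hcm]; field_simp
  have hcp' : cp * (θ2p + θ1p) = θ2p - θ2m := by rw [hcp]; field_simp
  have hcm1 : 0 < 1 - cm := by
    have : (1 - cm) * (θ2m + θ1m) = θ2m + θ1p := by linarith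
    exact pos_of_mul_pos_left (by rw [this]; positivity) (by positivity)
  have hcp1 : 0 < 1 - cp := by
    have : (1 - cp) * (θ2p + θ1p) = θ1p + θ2m := by linarith
    exact pos_of_mul_pos_left (by rw [this]; positivity) (by positivity)
  set X := exp (θ1m * a) with hX
  set B := exp (-(θ2m * a)) with hB
  have hX0 : 0 < X := exp_pos _
  have hB0 : 0 < B := exp_pos _
  have hBX : B < X := by
    refine exp_lt_exp.2 ?_
    have := mul_pos T1 ha
    have := mul_pos T2 ha
    linarith
  have hgm0 : gm 0 = cm * B + (1 - cm) * X := by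
    rw [hgm, if_neg ha.not_gt, hX, hB]; ring_nf
  have hgp0 : gp 0 = B := by
    rw [hgp, if_neg ha.not_gt, hB]; ring_nf
  set A := cm * B + (1 - cm) * X with hA
  have hAB : B < A := by nlinarith
  have hA0 : 0 < A := hB0.trans hAB
  -- On each side of `a`, the function `g` is a combination of two exponentials.
  have hg' : g = fun x => if a < x
      then A * (1 - cp) * exp (θ2p * (x - a)) + (A * cp - B) * exp (-θ1p * (x - a))
      else (1 - cm) * X * exp (θ2m * (x - a)) + -((1 - cm) * B) * exp (-θ1m * (x - a)) := by
    funext x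
    rw [hg, hgm0, hgp0, hgm, hgp]
    split_ifs
    · ring
    · rw [hA]; ring
  set h₁ : ℝ → ℝ := fun x => (1 - cm) * X * θ2m * exp (θ2m * (x - a)) +
    -(-((1 - cm) * B) * θ1m) * exp (-θ1m * (x - a)) with hh₁
  set h₂ : ℝ → ℝ := fun x => A * (1 - cp) * θ2p * exp (θ2p * (x - a)) +
    -((A * cp - B) * θ1p) * exp (-θ1p * (x - a)) with hh₂
  have hglue : h₁ a = h₂ a := by
    simp only [hh₁, hh₂, sub_self, mul_zero, exp_zero, mul_one]
    rw [hA]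
    linear_combination (-B) * hcm' + (cm * B + (1 - cm) * X) * hcp'
  set h : ℝ → ℝ := fun x => if a < x then h₂ x else h₁ x with hh
  have hd : ∀ x, HasDerivAt g (h x) x := fun x => by
    rw [hg']
    exact hasDerivAt_ite_lt (fun x => hasDerivAt_exp_add_exp _ _ _ _ a x)
      (fun x => hasDerivAt_exp_add_exp _ _ _ _ a x) (by simp [hA]; ring) hglue x
  have hc₁ : Continuous h₁ := by simp only [hh₁]; fun_prop
  have hc₂ : Continuous h₂ := by simp only [hh₂]; fun_prop
  have hc : Continuous h := by
    have : h = fun x => if x ≤ a then h₁ x else h₂ x := by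
      funext x
      by_cases hx : a < x
      · simp [hh, hx]
      · simp [hh, hx, not_lt.1 hx]
    rw [this]
    exact hc₁.if_le hc₂ continuous_id continuous_const (by rintro x rfl; exact hglue)
  have hmono₂ : StrictMonoOn h₂ (Ici a) := by
    refine strictMonoOn_of_deriv_pos (convex_Ici a) hc₂.continuousOn fun x hx => ?_
    rw [interior_Ici] at hx
    have hxa : 0 < x - a := sub_pos.2 hx
    rw [(hasDerivAt_exp_add_exp _ _ _ _ a x).deriv]
    have hE : exp (-θ1p * (x - a)) ≤ exp (θ2p * (x - a)) := by
      refine exp_le_exp.2 ?_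
      have := mul_pos t1 hxa
      have := mul_pos t2 hxa
      linarith
    have hE0 : 0 < exp (-θ1p * (x - a)) := exp_pos _
    have hP : 0 < A * (1 - cp) := mul_pos hA0 hcp1
    have hsq : θ1p ^ 2 * exp (-θ1p * (x - a)) ≤ θ2p ^ 2 * exp (θ2p * (x - a)) := by gcongr
    have hpos : 0 < θ1p ^ 2 * exp (-θ1p * (x - a)) := by positivity
    have h1 := mul_le_mul_of_nonneg_left hsq hP.le
    have h2 := mul_pos (sub_pos.2 hAB) hpos
    linarith
  have hpos₁ : ∀ x, 0 < h₁ x := fun x => by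
    have h1 : 0 < (1 - cm) * X * θ2m * exp (θ2m * (x - a)) := by positivity
    have h2 : 0 < (1 - cm) * B * θ1m * exp (-θ1m * (x - a)) := by positivity
    simp only [hh₁]
    linarith
  have hpos : ∀ x, 0 < h x := fun x => by
    by_cases hx : a < x
    · simp only [hh, if_pos hx]
      exact (hglue ▸ hpos₁ a).trans (hmono₂ (mem_Ici.2 le_rfl) (mem_Ici.2 hx.le) hx)
    · simp only [hh, if_neg hx]
      exact hpos₁ x
  have htop : Tendsto h atTop atTop := by
    have h1 : Tendsto (fun x => A * (1 - cp) * θ2p * exp (θ2p * (x - a)) +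
        -|(A * cp - B) * θ1p|) atTop atTop := by
      refine tendsto_atTop_add_const_right _ _ (Tendsto.const_mul_atTop (by positivity) ?_)
      exact tendsto_exp_atTop.comp
        ((tendsto_atTop_add_const_right _ (-a) tendsto_id).const_mul_atTop t2)
    refine tendsto_atTop_mono' _ ?_ h1
    filter_upwards [eventually_gt_atTop a] with x hx
    simp only [hh, if_pos hx, hh₂]
    have hE0 : 0 < exp (-θ1p * (x - a)) := exp_pos _
    have hE1 : exp (-θ1p * (x - a)) ≤ 1 := by
      refine exp_le_one_iff.2 ?_
      have := mul_pos t1 (sub_pos.2 hx)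
      linarith
    have h2 := le_abs_self ((A * cp - B) * θ1p)
    have h3 := abs_nonneg ((A * cp - B) * θ1p)
    nlinarith
  have hd₁ : ∀ x, deriv h₁ x = (1 - cm) * exp ((θ1m - θ2m) * a - θ1m * x) *
      (θ2m ^ 2 * exp ((θ2m + θ1m) * x) - θ1m ^ 2) := fun x => by
    rw [(hasDerivAt_exp_add_exp _ _ _ _ a x).deriv]
    have e1 : X * exp (θ2m * (x - a)) =
        exp ((θ1m - θ2m) * a - θ1m * x) * exp ((θ2m + θ1m) * x) := by
      rw [hX, ← exp_add, ← exp_add]; ring_nf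
    have e2 : B * exp (-θ1m * (x - a)) = exp ((θ1m - θ2m) * a - θ1m * x) := by
      rw [hB, ← exp_add]; ring_nf
    linear_combination (1 - cm) * θ2m ^ 2 * e1 - (1 - cm) * θ1m ^ 2 * e2
  have ha₁' : θ2m ^ 2 * exp ((θ2m + θ1m) * a₁) = θ1m ^ 2 := by
    have : (θ2m + θ1m) * a₁ = log (θ1m / θ2m) + log (θ1m / θ2m) := by
      rw [ha₁]; field_simp; ring
    rw [this, exp_add, exp_log (by positivity)]
    field_simp
  have ha₁0 : 0 < a₁ := by
    rw [ha₁]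
    have := log_pos ((one_lt_div T2).2 hT)
    positivity
  have hb0 : 0 < b := by rw [hb]; exact lt_min ha ha₁0
  have hba : b ≤ a := hb ▸ min_le_left _ _
  have hba₁ : b ≤ a₁ := hb ▸ min_le_right _ _
  have heq₁ : EqOn h₁ h (Iic a) := fun x hx => by simp [hh, not_lt.2 (mem_Iic.1 hx)]
  have heq₂ : EqOn h₂ h (Ici a) := fun x hx => by
    rcases eq_or_lt_of_le (mem_Ici.1 hx) with rfl | hx
    · simp [hh, hglue]
    · simp [hh, hx]
  have hanti : StrictAntiOn h (Icc 0 b) := by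
    refine StrictAntiOn.congr (f₁ := h₁) ?_ (heq₁.mono fun x hx => hx.2.trans hba)
    refine strictAntiOn_of_deriv_neg (convex_Icc 0 b) hc₁.continuousOn fun x hx => ?_
    rw [interior_Icc] at hx
    rw [hd₁, ← ha₁', ← mul_sub]
    refine mul_neg_of_pos_of_neg (by positivity) (mul_neg_of_pos_of_neg (by positivity) ?_)
    refine sub_neg.2 (exp_lt_exp.2 ?_)
    have := hx.2.trans_le hba₁
    gcongr
  have hmono : StrictMonoOn h (Ici b) := by
    rw [← Icc_union_Ici_eq_Ici hba]
    refine StrictMonoOn.union ?_ (hmono₂.congr heq₂) (isGreatest_Icc hba) isLeast_Ici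
    refine StrictMonoOn.congr (f₁ := h₁) ?_ (heq₁.mono fun x hx => hx.2)
    refine strictMonoOn_of_deriv_pos (convex_Icc b a) hc₁.continuousOn fun x hx => ?_
    rw [interior_Icc] at hx
    have hx₁ : a₁ < x := by
      rcases min_lt_iff.1 (hb ▸ hx.1) with h1 | h1
      · exact absurd h1 hx.2.not_gt
      · exact h1
    rw [hd₁, ← ha₁', ← mul_sub]
    refine mul_pos (by positivity) (mul_pos (by positivity) ?_)
    refine sub_pos.2 (exp_lt_exp.2 ?_)
    gcongr
  have hderiv : deriv g = h := funext fun x => (hd x).deriv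
  rw [hderiv] at hι hφ hψ ⊢
  have hφ' : ∀ x, φ x = (x - ι (h x)) - (g x - g (ι (h x))) / h x := fun x => by
    rw [hφ, hψ, intervalIntegral.integral_sub intervalIntegrable_const
      ((hc.div_const _).intervalIntegrable _ _), intervalIntegral.integral_div,
      intervalIntegral.integral_eq_sub_of_hasDerivAt (fun s _ => hd s)
        (hc.intervalIntegrable _ _)]
    simp
  have key := existsUnique_maximizer_of_valley hb0 hβ hd hc hpos hanti hmono htop hι hφ'
  subst hM hD
  simpa only [hζ, mem_ofPred_eq] using key
end

section
/- Assume μ₊ > 0 and μ₋ ≤ 0. If one of the following holds: (c₊ > 0 and a ≥ a₂), or (c₊ > 0 and 0 < a₃ ≤ a ≤ a₂), or (c₊ ≤ 0, Θ > 0 and a ≥ a₃), then g is convex on (0,∞). If instead one of the following holds: (c₊ > 0 and 0 < a < min(a₂,a₃)), or (c₊ ≤ 0 and Θ ≤ 0), or (c₊ ≤ 0, Θ > 0 and 0 < a < a₃), then g is convex on (0,a), concave on (a,x₀), and convex on (x₀,∞). -/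
open Real Set Filter

lemma abs_lt_sqrt_sq_add {μ c : ℝ} (hc : 0 < c) : |μ| < Real.sqrt (μ ^ 2 + c) := by
  rw [← Real.sqrt_sq_eq_abs]
  exact Real.sqrt_lt_sqrt (sq_nonneg μ) (by linarith)

lemma hasDerivAt_const_mul_exp (p b a x : ℝ) :
    HasDerivAt (fun y => p * Real.exp (b * (y - a))) (p * b * Real.exp (b * (x - a))) x := by
  have h : HasDerivAt (fun y => b * (y - a)) b x := by
    simpa using ((hasDerivAt_id x).sub_const a).const_mul b
  exact (h.exp.const_mul p).congr_deriv (by ring)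

/-- A combination of two exponentials centred at `a`. -/
noncomputable def expComb (a p b r s x : ℝ) : ℝ :=
  p * Real.exp (b * (x - a)) + r * Real.exp (s * (x - a))

lemma hasDerivAt_expComb (a p b r s x : ℝ) :
    HasDerivAt (expComb a p b r s) (expComb a (p * b) b (r * s) s x) x :=
  (hasDerivAt_const_mul_exp p b a x).add (hasDerivAt_const_mul_exp r s a x)

lemma deriv_expComb (a p b r s : ℝ) :
    deriv (expComb a p b r s) = expComb a (p * b) b (r * s) s :=
  funext fun x => (hasDerivAt_expComb a p b r s x).deriv

lemma differentiable_expComb (a p b r s : ℝ) : Differentiable ℝ (expComb a p b r s) :=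
  fun x => (hasDerivAt_expComb a p b r s x).differentiableAt

lemma monotoneOn_deriv_expComb {a p b r s : ℝ} {S : Set ℝ} (hS : Convex ℝ S)
    (h : ∀ x ∈ S, 0 ≤ expComb a (p * b * b) b (r * s * s) s x) :
    MonotoneOn (expComb a (p * b) b (r * s) s) S := by
  refine monotoneOn_of_deriv_nonneg hS (differentiable_expComb _ _ _ _ _).continuous.continuousOn
    (differentiable_expComb _ _ _ _ _).differentiableOn fun x hx => ?_
  rw [deriv_expComb]
  exact h x (interior_subset hx)

lemma convexOn_expComb {a p b r s : ℝ} {S : Set ℝ} (hS : Convex ℝ S)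
    (h : ∀ x ∈ S, 0 ≤ expComb a (p * b * b) b (r * s * s) s x) :
    ConvexOn ℝ S (expComb a p b r s) := by
  refine MonotoneOn.convexOn_of_deriv hS (differentiable_expComb _ _ _ _ _).continuous.continuousOn
    (differentiable_expComb _ _ _ _ _).differentiableOn ?_
  rw [deriv_expComb]
  exact (monotoneOn_deriv_expComb hS h).mono interior_subset

lemma concaveOn_expComb {a p b r s : ℝ} {S : Set ℝ} (hS : Convex ℝ S)
    (h : ∀ x ∈ S, expComb a (p * b * b) b (r * s * s) s x ≤ 0) :
    ConcaveOn ℝ S (expComb a p b r s) := by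
  have hneg : ∀ p r, expComb a (-p) b (-r) s = -expComb a p b r s := fun p r => by
    funext x; simp only [expComb, Pi.neg_apply]; ring
  rw [← neg_convexOn_iff, ← hneg]
  refine convexOn_expComb hS fun x hx => ?_
  have := h x hx
  simp only [neg_mul, hneg, Pi.neg_apply]
  linarith

/-- Gluing two functions to first order at `a` gives a convex function as soon as both derivatives
are monotone. -/
lemma convexOn_Ioi_of_glue {f₁ f₂ f₁' f₂' g : ℝ → ℝ} {l a : ℝ} (hl : l < a)
    (h₁ : ∀ x, HasDerivAt f₁ (f₁' x) x) (h₂ : ∀ x, HasDerivAt f₂ (f₂' x) x)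
    (hv : f₁ a = f₂ a) (hd : f₁' a = f₂' a)
    (hm₁ : MonotoneOn f₁' (Set.Ioc l a)) (hm₂ : MonotoneOn f₂' (Set.Ici a))
    (hg₁ : ∀ x ≤ a, g x = f₁ x) (hg₂ : ∀ x, a < x → g x = f₂ x) :
    ConvexOn ℝ (Set.Ioi l) g := by
  have hg₂' : ∀ x, a ≤ x → g x = f₂ x := fun x hx => by
    rcases hx.eq_or_lt with rfl | hx
    · rw [hg₁ _ le_rfl, hv]
    · exact hg₂ x hx
  have hder : ∀ x, HasDerivAt g (if a < x then f₂' x else f₁' x) x := by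
    intro x
    rcases lt_trichotomy x a with hx | rfl | hx
    · rw [if_neg hx.not_gt]
      refine (h₁ x).congr_of_eventuallyEq ?_
      filter_upwards [Iio_mem_nhds hx] with y hy using hg₁ y (le_of_lt hy)
    · rw [if_neg (lt_irrefl x), ← hasDerivWithinAt_univ, ← Set.Iic_union_Ici (a := x)]
      refine HasDerivWithinAt.union ?_ ?_
      · exact (h₁ x).hasDerivWithinAt.congr (fun y hy => hg₁ y hy) (hg₁ x le_rfl)
      · rw [hd]
        exact (h₂ x).hasDerivWithinAt.congr (fun y hy => hg₂' y hy) (hg₂' x le_rfl)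
    · rw [if_pos hx]
      refine (h₂ x).congr_of_eventuallyEq ?_
      filter_upwards [Ioi_mem_nhds hx] with y hy using hg₂ y hy
  have hdiff : Differentiable ℝ g := fun x => (hder x).differentiableAt
  refine MonotoneOn.convexOn_of_deriv (convex_Ioi l) hdiff.continuous.continuousOn
    hdiff.differentiableOn ?_
  rw [interior_Ioi]
  intro x hx y hy hxy
  rw [(hder x).deriv, (hder y).deriv]
  split_ifs with hax hay hay
  · exact hm₂ hax.le hay.le hxy
  · exact absurd (hax.trans_le hxy) hay
  · exact (hm₁ ⟨hx, not_lt.1 hax⟩ ⟨hl, le_rfl⟩ (not_lt.1 hax)).trans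
      (hd.trans_le (hm₂ Set.self_mem_Ici hay.le hay.le))
  · exact hm₁ ⟨hx, not_lt.1 hax⟩ ⟨hy, not_lt.1 hay⟩ hxy

theorem statement13
    (a q μp μm σp σm : ℝ)
    (ha : 0 < a) (hq : 0 < q) (hσp : 0 < σp) (hσm : 0 < σm)
    (θ1p θ2p θ1m θ2m cm cp : ℝ)
    (hθ1p : θ1p = (Real.sqrt (μp ^ 2 + 2 * q * σp ^ 2) + μp) / σp ^ 2)
    (hθ2p : θ2p = (Real.sqrt (μp ^ 2 + 2 * q * σp ^ 2) - μp) / σp ^ 2)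
    (hθ1m : θ1m = (Real.sqrt (μm ^ 2 + 2 * q * σm ^ 2) + μm) / σm ^ 2)
    (hθ2m : θ2m = (Real.sqrt (μm ^ 2 + 2 * q * σm ^ 2) - μm) / σm ^ 2)
    (hcm : cm = (θ1m - θ1p) / (θ2m + θ1m))
    (hcp : cp = (θ2p - θ2m) / (θ2p + θ1p))
    (gm gp g : ℝ → ℝ)
    (hgm : ∀ x, gm x = if a < x then Real.exp (-θ1p * (x - a))
      else cm * Real.exp (θ2m * (x - a)) + (1 - cm) * Real.exp (-θ1m * (x - a)))
    (hgp : ∀ x, gp x = if a < x then (1 - cp) * Real.exp (θ2p * (x - a)) + cp * Real.exp (-θ1p * (x - a))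
      else Real.exp (θ2m * (x - a)))
    (hg : ∀ x, g x = gp x * gm 0 - gm x * gp 0)
    (hμp : 0 < μp) (hμm : μm ≤ 0)
    (Θ : ℝ)
    (hΘ : Θ = cp * θ1p ^ 2 + (1 - cp) * θ2p ^ 2)
    (x₀ : ℝ)
    (hx₀ : x₀ = a + Real.log ((gp 0 - cp * gm 0) * θ1p ^ 2 / ((1 - cp) * gm 0 * θ2p ^ 2)) / (θ2p + θ1p))
    (a₂ : ℝ)
    (ha₂ : a₂ = Real.log ((θ2p + θ1m) / (θ2p - θ2m)) / (θ1m + θ2m))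
    (a₃ : ℝ)
    (ha₃ : a₃ = Real.log (((1 - cm * cp) * θ1p ^ 2 - (1 - cp) * cm * θ2p ^ 2) / ((1 - cm) * Θ)) / (θ1m + θ2m))
    :
    (((0 < cp ∧ a₂ ≤ a) ∨ (0 < cp ∧ 0 < a₃ ∧ a₃ ≤ a ∧ a ≤ a₂) ∨ (cp ≤ 0 ∧ 0 < Θ ∧ a₃ ≤ a)) →
        ConvexOn ℝ (Set.Ioi 0) g) ∧
      (((0 < cp ∧ 0 < a ∧ a < min a₂ a₃) ∨ (cp ≤ 0 ∧ Θ ≤ 0) ∨ (cp ≤ 0 ∧ 0 < Θ ∧ 0 < a ∧ a < a₃)) →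
        ConvexOn ℝ (Set.Ioo 0 a) g ∧ ConcaveOn ℝ (Set.Ioo a x₀) g ∧ ConvexOn ℝ (Set.Ioi x₀) g) := by
  obtain ⟨hB, hBA⟩ : 0 < θ2p ∧ θ2p < θ1p := by
    have h := abs_lt.1 (abs_lt_sqrt_sq_add (μ := μp) (c := 2 * q * σp ^ 2) (by positivity))
    rw [hθ1p, hθ2p]
    exact ⟨div_pos (by linarith [h.2]) (by positivity), by gcongr; linarith⟩
  obtain ⟨hC, hCD⟩ : 0 < θ1m ∧ θ1m ≤ θ2m := by
    have h := abs_lt.1 (abs_lt_sqrt_sq_add (μ := μm) (c := 2 * q * σm ^ 2) (by positivity))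
    rw [hθ1m, hθ2m]
    exact ⟨div_pos (by linarith [h.1]) (by positivity), by gcongr; linarith⟩
  clear hθ1p hθ2p hθ1m hθ2m
  have hA : 0 < θ1p := hB.trans hBA
  have hD : 0 < θ2m := hC.trans_le hCD
  have hAB : 0 < θ2p + θ1p := by positivity
  have hDC : 0 < θ2m + θ1m := by positivity
  have hcm1 : 1 - cm = (θ2m + θ1p) / (θ2m + θ1m) := by rw [hcm]; field_simp; ring
  have hcp1 : 1 - cp = (θ1p + θ2m) / (θ2p + θ1p) := by rw [hcp]; field_simp; ring
  have hcm1pos : 0 < 1 - cm := hcm1 ▸ by positivity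
  have hcp1pos : 0 < 1 - cp := hcp1 ▸ by positivity
  have hdm : cm * θ2m - (1 - cm) * θ1m = -θ1p := by rw [hcm1, hcm]; field_simp; ring
  have hdp : (1 - cp) * θ2p - cp * θ1p = θ2m := by rw [hcp1, hcp]; field_simp; ring
  -- the values at `0`
  set t := Real.exp (-(θ2m * a)) with ht
  set E := Real.exp ((θ1m + θ2m) * a) with hE
  have htpos : 0 < t := Real.exp_pos _
  have hE1 : 1 < E := Real.one_lt_exp_iff.2 (by positivity)
  have hs : Real.exp (θ1m * a) = t * E := by rw [ht, hE, ← Real.exp_add]; ring_nf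
  have hgp0 : gp 0 = t := by
    rw [hgp, if_neg ha.not_gt, ht]; ring_nf
  have hgm0 : gm 0 = t * (cm + (1 - cm) * E) := by
    rw [hgm, if_neg ha.not_gt, show -θ1m * (0 - a) = θ1m * a by ring, hs,
      show θ2m * (0 - a) = -(θ2m * a) by ring, ← ht]
    ring
  have hMpos : 0 < cm + (1 - cm) * E := by nlinarith
  have hgm0pos : 0 < gm 0 := hgm0 ▸ mul_pos htpos hMpos
  set P := (1 - cp) * gm 0 with hP
  set K := gp 0 - cp * gm 0 with hK
  have hPpos : 0 < P := mul_pos hcp1pos hgm0pos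
  set f₁ := expComb a ((1 - cm) * (t * E)) θ2m (-(t * (1 - cm))) (-θ1m) with hf₁
  set f₂ := expComb a P θ2p (-K) (-θ1p) with hf₂
  have hg₁ : ∀ x ≤ a, g x = f₁ x := fun x hx => by
    rw [hg, hgp x, hgm x, if_neg hx.not_gt, if_neg hx.not_gt, hgp0, hgm0, hf₁, expComb]
    ring
  have hg₂ : ∀ x, a < x → g x = f₂ x := fun x hx => by
    rw [hg, hgp x, hgm x, if_pos hx, if_pos hx, hf₂, expComb]
    ring
  have hconv₁ : ∀ x, 0 < x → 0 ≤ expComb a ((1 - cm) * (t * E) * θ2m * θ2m) θ2m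
      (-(t * (1 - cm)) * -θ1m * -θ1m) (-θ1m) x := by
    intro x hx
    have h1 : t * Real.exp (-θ1m * (x - a)) ≤ t * E * Real.exp (θ2m * (x - a)) := by
      rw [← hs, ht, ← Real.exp_add, ← Real.exp_add, Real.exp_le_exp]
      linarith [mul_pos hDC hx]
    have h2 : θ1m ^ 2 * (t * Real.exp (-θ1m * (x - a))) ≤
        θ2m ^ 2 * (t * E * Real.exp (θ2m * (x - a))) := by gcongr
    have h3 := mul_le_mul_of_nonneg_left h2 hcm1pos.le
    rw [expComb]
    linarith
  -- the sign of the second derivative to the right of `a`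
  have hcurv : P * θ2p ^ 2 - K * θ1p ^ 2 = t * ((cm + (1 - cm) * E) * Θ - θ1p ^ 2) := by
    rw [hP, hK, hΘ, hgp0, hgm0]; ring
  have hN : (1 - cm * cp) * θ1p ^ 2 - (1 - cp) * cm * θ2p ^ 2 = θ1p ^ 2 - cm * Θ := by
    rw [hΘ]; ring
  have hsq : θ2p ^ 2 < θ1p ^ 2 := by gcongr
  have hΘA : Θ < θ1p ^ 2 := by rw [hΘ]; linarith [mul_pos hcp1pos (sub_pos.2 hsq)]
  have hΘpos : 0 < cp → 0 < Θ := fun h => by rw [hΘ]; positivity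
  have hR : 0 < Θ → Real.exp ((θ1m + θ2m) * a₃) = (θ1p ^ 2 - cm * Θ) / ((1 - cm) * Θ) := by
    intro h
    have : 0 < θ1p ^ 2 - cm * Θ := by linarith [mul_pos hcm1pos h]
    rw [ha₃, hN, mul_div_cancel₀ _ (by positivity), Real.exp_log (by positivity)]
  have ha₃_le : 0 < Θ → a₃ ≤ a → K * θ1p ^ 2 ≤ P * θ2p ^ 2 := by
    intro h h3
    have h4 : Real.exp ((θ1m + θ2m) * a₃) ≤ E := Real.exp_le_exp.2 (by gcongr)
    rw [hR h, div_le_iff₀ (by positivity)] at h4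
    have := mul_nonneg htpos.le (sub_nonneg.2 h4)
    linarith
  have ha₃_lt : 0 < Θ → a < a₃ → P * θ2p ^ 2 < K * θ1p ^ 2 := by
    intro h h3
    have h4 : E < Real.exp ((θ1m + θ2m) * a₃) := Real.exp_lt_exp.2 (by gcongr)
    rw [hR h, lt_div_iff₀ (by positivity)] at h4
    have := mul_pos htpos (sub_pos.2 h4)
    linarith
  have ha₂_le : 0 < cp → a₂ ≤ a → K ≤ 0 := by
    intro h h2
    have hBD : 0 < θ2p - θ2m := by
      rw [hcp] at h
      exact (div_pos_iff_of_pos_right hAB).1 h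
    have h4 : Real.exp ((θ1m + θ2m) * a₂) ≤ E := Real.exp_le_exp.2 (by gcongr)
    rw [ha₂, mul_div_cancel₀ _ (by positivity), Real.exp_log (by positivity),
      div_le_iff₀ hBD] at h4
    have h5 : 1 - cp * (cm + (1 - cm) * E) =
        (θ1p + θ2m) / ((θ2p + θ1p) * (θ2m + θ1m)) * (θ2p + θ1m - E * (θ2p - θ2m)) := by
      rw [hcm1, hcp, hcm]; field_simp; ring
    have h6 : 1 - cp * (cm + (1 - cm) * E) ≤ 0 := by
      rw [h5]
      exact mul_nonpos_of_nonneg_of_nonpos (by positivity) (by linarith)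
    rw [hK, hgp0, hgm0]
    linarith [mul_nonpos_of_nonneg_of_nonpos htpos.le h6]
  constructor
  · intro h
    have hKP : K * θ1p ^ 2 ≤ P * θ2p ^ 2 := by
      rcases h with ⟨h1, h2⟩ | ⟨h1, -, h3, -⟩ | ⟨-, h2, h3⟩
      · exact (mul_nonpos_of_nonpos_of_nonneg (ha₂_le h1 h2) (sq_nonneg _)).trans (by positivity)
      · exact ha₃_le (hΘpos h1) h3
      · exact ha₃_le h2 h3
    refine convexOn_Ioi_of_glue ha (fun x => hasDerivAt_expComb ..)
      (fun x => hasDerivAt_expComb ..) ?_ ?_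
      (monotoneOn_deriv_expComb (convex_Ioc 0 a) fun x hx => hconv₁ x hx.1)
      (monotoneOn_deriv_expComb (convex_Ici a) fun x hx => ?_) hg₁ hg₂
    · simp only [expComb, sub_self, mul_zero, Real.exp_zero, hP, hK, hgp0, hgm0]; ring
    · simp only [expComb, sub_self, mul_zero, Real.exp_zero, hP, hK, hgp0]
      have e : gm 0 * ((1 - cp) * θ2p - cp * θ1p) + t * θ1p = gm 0 * θ2m - t * -θ1p := by
        rw [hdp]; ring
      rw [← hdm, hgm0] at e
      rw [hgm0]
      linarith
    · have hxa : 0 ≤ x - a := sub_nonneg.2 hx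
      have h1 : Real.exp (-θ1p * (x - a)) ≤ Real.exp (θ2p * (x - a)) :=
        Real.exp_le_exp.2 (by linarith [mul_nonneg hAB.le hxa])
      have h2 := mul_le_mul_of_nonneg_right hKP (Real.exp_pos (-θ1p * (x - a))).le
      have h3 := mul_le_mul_of_nonneg_left h1 (by positivity : 0 ≤ P * θ2p ^ 2)
      rw [expComb]
      linarith
  · intro h
    have hKP : P * θ2p ^ 2 < K * θ1p ^ 2 := by
      rcases h with ⟨h1, -, h3⟩ | ⟨-, h2⟩ | ⟨-, h2, -, h3⟩
      · exact ha₃_lt (hΘpos h1) (h3.trans_le (min_le_right _ _))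
      · have h3 := mul_nonpos_of_nonneg_of_nonpos hMpos.le h2
        have h4 : t * ((cm + (1 - cm) * E) * Θ - θ1p ^ 2) < 0 :=
          mul_neg_of_pos_of_neg htpos (by linarith [pow_pos hA 2])
        linarith
      · exact ha₃_lt h2 h3
    have hPB : 0 < P * θ2p ^ 2 := by positivity
    have hratio : 1 < K * θ1p ^ 2 / (P * θ2p ^ 2) := (one_lt_div hPB).2 hKP
    have hax₀ : a < x₀ := by
      have := div_pos (Real.log_pos hratio) hAB
      linarith
    have hKA : K * θ1p ^ 2 = P * θ2p ^ 2 * Real.exp ((θ2p + θ1p) * (x₀ - a)) := by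
      rw [hx₀, add_sub_cancel_left, mul_div_cancel₀ _ hAB.ne',
        Real.exp_log (zero_lt_one.trans hratio), mul_div_cancel₀ _ hPB.ne']
    have hf₂'' : ∀ x, expComb a (P * θ2p * θ2p) θ2p (-K * -θ1p * -θ1p) (-θ1p) x =
        P * θ2p ^ 2 * (Real.exp (θ2p * (x - a)) -
          Real.exp ((θ2p + θ1p) * (x₀ - a) + -θ1p * (x - a))) := fun x => by
      rw [expComb, Real.exp_add]
      linear_combination (-Real.exp (-θ1p * (x - a))) * hKA
    refine ⟨?_, ?_, ?_⟩
    · exact (convexOn_expComb (convex_Ioo 0 a) fun x hx => hconv₁ x hx.1).congr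
        fun x hx => (hg₁ x hx.2.le).symm
    · refine (concaveOn_expComb (convex_Ioo a x₀) fun x hx => ?_).congr
        fun x hx => (hg₂ x hx.1).symm
      rw [hf₂'']
      refine mul_nonpos_of_nonneg_of_nonpos hPB.le (sub_nonpos.2 (Real.exp_le_exp.2 ?_))
      linarith [mul_pos hAB (sub_pos.2 hx.2)]
    · refine (convexOn_expComb (convex_Ioi x₀) fun x hx => ?_).congr
        fun x hx => (hg₂ x (hax₀.trans hx)).symm
      rw [hf₂'']
      refine mul_nonneg hPB.le (sub_nonneg.2 (Real.exp_le_exp.2 ?_))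
      linarith [mul_pos hAB (sub_pos.2 (Set.mem_Ioi.1 hx))]
end

section
/- Assume μ₊ > 0, μ₋ ≤ 0, and that one of the following holds: (c₊ > 0 and a ≥ a₂), or (c₊ > 0 and 0 < a₃ ≤ a ≤ a₂), or (c₊ ≤ 0, Θ > 0 and a ≥ a₃). Then there exists a unique z₂ ∈ (0,∞) with ψ(0,z₂) = β, and M_ζ = {(0, z₂)}. -/
open Real Set Filter

theorem hasDerivAt_ite_le {L R L' R' : ℝ → ℝ} {a : ℝ} (hL : ∀ x, HasDerivAt L (L' x) x)
    (hR : ∀ x, HasDerivAt R (R' x) x) (h : L a = R a) (h' : L' a = R' a) (x : ℝ) :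
    HasDerivAt (fun x => if x ≤ a then L x else R x) (if x ≤ a then L' x else R' x) x := by
  rcases lt_trichotomy x a with hx | rfl | hx
  · rw [if_pos hx.le]
    refine (hL x).congr_of_eventuallyEq ?_
    filter_upwards [Iio_mem_nhds hx] with y hy
    exact if_pos (le_of_lt hy)
  · rw [if_pos le_rfl, ← hasDerivWithinAt_univ, ← Iic_union_Ici (a := x)]
    refine HasDerivWithinAt.union ?_ ?_
    · exact (hL x).hasDerivWithinAt.congr (fun y hy => if_pos hy) (if_pos le_rfl)
    · rw [h']
      refine (hR x).hasDerivWithinAt.congr (fun y hy => ?_) (by simp [h])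
      split_ifs with hyx
      · rw [le_antisymm hyx hy, h]
      · rfl
  · rw [if_neg hx.not_ge]
    refine (hR x).congr_of_eventuallyEq ?_
    filter_upwards [Ioi_mem_nhds hx] with y hy
    exact if_neg (not_le.2 hy)

theorem strictMonoOn_ite_le {L R : ℝ → ℝ} {a b : ℝ} (hba : b ≤ a) (hL : StrictMonoOn L (Icc b a))
    (hR : StrictMonoOn R (Ici a)) (h : L a = R a) :
    StrictMonoOn (fun x => if x ≤ a then L x else R x) (Ici b) := by
  rw [← Icc_union_Ici_eq_Ici hba]
  refine StrictMonoOn.union (c := a) ?_ ?_ (isGreatest_Icc hba) isLeast_Ici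
  · exact hL.congr fun x hx => (if_pos hx.2).symm
  · refine hR.congr fun x hx => ?_
    split_ifs with hxa
    · rw [le_antisymm hxa hx, h]
    · rfl

theorem hasDerivAt_exp_mul_sub (k a x : ℝ) :
    HasDerivAt (fun x => exp (k * (x - a))) (k * exp (k * (x - a))) x := by
  exact (((hasDerivAt_id' x).sub_const a).const_mul k).exp.congr_deriv (by ring)

theorem strictMonoOn_exp_sub_exp {u v p r : ℝ} (hp : 0 < p) (hr : 0 < r) (hu : 0 < u)
    (huv : 0 ≤ u * p + v * r) :
    StrictMonoOn (fun y => u * exp (p * y) - v * exp (-r * y)) (Ici 0) := by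
  have hd (y : ℝ) : HasDerivAt (fun y => u * exp (p * y) - v * exp (-r * y))
      (u * p * exp (p * y) + v * r * exp (-r * y)) y := by
    have h1 := (hasDerivAt_exp_mul_sub p 0 y).const_mul u
    have h2 := (hasDerivAt_exp_mul_sub (-r) 0 y).const_mul v
    simp only [sub_zero] at h1 h2
    exact (h1.sub h2).congr_deriv (by ring)
  refine strictMonoOn_of_deriv_pos (convex_Ici 0)
    (fun y _ => (hd y).continuousAt.continuousWithinAt) fun y hy => ?_
  rw [interior_Ici, mem_Ioi] at hy
  rw [(hd y).deriv]
  have hup : 0 < u * p := mul_pos hu hp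
  have h1 : 1 < exp (p * y) := one_lt_exp_iff.2 (mul_pos hp hy)
  have h2 : exp (-r * y) ≤ 1 := exp_le_one_iff.2 (by nlinarith)
  have h3 := exp_pos (-r * y)
  rcases le_total 0 v with hv | hv
  · positivity
  · nlinarith [mul_nonneg (neg_nonneg.2 hv) hr.le]

theorem le_exp_mul_of_log_div_le {x s a : ℝ} (hs : 0 < s) (h : log x / s ≤ a) :
    x ≤ exp (s * a) :=
  (le_exp_log x).trans (exp_le_exp.2 (by rwa [div_le_iff₀' hs] at h))

theorem mul_sub_lt_sub_of_strictMonoOn_deriv {g h : ℝ → ℝ}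
    (hder : ∀ x, HasDerivAt g (h x) x) (hmono : StrictMonoOn h (Ici 0))
    {z w : ℝ} (hz : 0 ≤ z) (hw : 0 ≤ w) (hne : w ≠ z) :
    h z * (w - z) < g w - g z := by
  have hcont : Continuous g := continuous_iff_continuousAt.2 fun x => (hder x).continuousAt
  rcases hne.lt_or_gt with hlt | hlt
  · obtain ⟨c, hc, he⟩ := exists_hasDerivAt_eq_slope g h hlt hcont.continuousOn fun x _ => hder x
    have := hmono (hw.trans hc.1.le) hz hc.2
    rw [eq_div_iff (by linarith)] at he
    nlinarith
  · obtain ⟨c, hc, he⟩ := exists_hasDerivAt_eq_slope g h hlt hcont.continuousOn fun x _ => hder x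
    have := hmono hz (hz.trans hc.1.le) hc.1
    rw [eq_div_iff (by linarith)] at he
    nlinarith

theorem sub_lt_sub_shift_of_strictMonoOn_deriv {g h : ℝ → ℝ}
    (hder : ∀ x, HasDerivAt g (h x) x) (hmono : StrictMonoOn h (Ici 0))
    {x w : ℝ} (hx : 0 < x) (hw : 0 < w) :
    g w - g 0 < g (w + x) - g x := by
  have hd (t : ℝ) : HasDerivAt (fun t => g (t + x) - g t) (h (t + x) - h t) t :=
    ((hder (t + x)).comp_add_const t x).sub (hder t)
  have := strictMonoOn_of_deriv_pos (convex_Ici 0)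
    (fun t _ => (hd t).continuousAt.continuousWithinAt) (fun t ht => by
      rw [interior_Ici, mem_Ioi] at ht
      rw [(hd t).deriv, sub_pos]
      exact hmono ht.le (by simp only [mem_Ici]; linarith) (by linarith))
  have := this self_mem_Ici hw.le hw
  simp only [zero_add] at this
  linarith

theorem exists_unique_tangent_point {g h : ℝ → ℝ}
    (hder : ∀ x, HasDerivAt g (h x) x) (hmono : StrictMonoOn h (Ici 0))
    (hcont : Continuous h) (h0 : 0 < h 0)
    (htop : Tendsto h atTop atTop) {β : ℝ} (hβ : 0 < β) :
    ∃ z, β < z ∧ g z - g 0 = h z * (z - β) ∧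
      (∀ w, 0 < w → g w - g 0 = h w * (w - β) → w = z) ∧
      ∀ x y, 0 ≤ x → x + β ≤ y → (x, y) ≠ (0, z) → h z * (y - x - β) < g y - g x := by
  have hpos {x : ℝ} (hx : 0 ≤ x) : 0 < h x := h0.trans_le (hmono.monotoneOn self_mem_Ici hx hx)
  have tangent {z w : ℝ} := mul_sub_lt_sub_of_strictMonoOn_deriv hder hmono (z := z) (w := w)
  have gcont : Continuous g := continuous_iff_continuousAt.2 fun x => (hder x).continuousAt
  have beta_lt {w : ℝ} (hw : 0 < w) (he : g w - g 0 = h w * (w - β)) : β < w := by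
    have h1 := tangent le_rfl hw.le hw.ne'
    have h2 : 0 < h w * (w - β) := by
      rw [← he]
      exact (by simpa using mul_pos h0 hw : 0 < h 0 * (w - 0)).trans h1
    linarith [(pos_iff_pos_of_mul_pos h2).1 (hpos hw.le)]
  obtain ⟨z, hz0, hz⟩ : ∃ z, 0 < z ∧ g z - g 0 = h z * (z - β) := by
    obtain ⟨Y, hYh, hYM⟩ := ((htop.eventually_ge_atTop (g (β + 1) - g 0)).and
      (eventually_gt_atTop (β + 1))).exists
    have hY0 : 0 ≤ Y := by linarith
    have hend : 0 ≤ h Y * (Y - β) - (g Y - g 0) := by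
      nlinarith [tangent hY0 (by linarith : 0 ≤ β + 1) hYM.ne]
    obtain ⟨z, hzm, hz⟩ := intermediate_value_Icc (f := fun y => h y * (y - β) - (g y - g 0)) hY0
      (by fun_prop) ⟨by simp only [zero_sub, sub_self]; nlinarith, hend⟩
    refine ⟨z, hzm.1.lt_of_ne ?_, by linarith⟩
    rintro rfl
    simp only [zero_sub, sub_self] at hz
    nlinarith
  have hβz := beta_lt hz0 hz
  refine ⟨z, hβz, hz, fun w hw0 hw => ?_, fun x y hx hxy hne => ?_⟩
  · by_contra hne
    have h1 := tangent hz0.le hw0.le hne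
    have h2 := tangent hw0.le hz0.le (Ne.symm hne)
    have hβw := beta_lt hw0 hw
    have h3 : h z < h w := by
      refine lt_of_mul_lt_mul_right (a := w - β) ?_ (by linarith)
      linarith
    have h4 : h w < h z := by
      refine lt_of_mul_lt_mul_right (a := z - β) ?_ (by linarith)
      linarith
    exact h3.not_gt h4
  · have hyx : 0 < y - x := by linarith
    have key : h z * (y - x - β) = h z * (y - x - z) + (g z - g 0) := by rw [hz]; ring
    rcases hx.eq_or_lt with rfl | hx
    · have := tangent hz0.le hyx.le (fun he => hne (by rw [← he, sub_zero]))
      simp only [sub_zero] at *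
      linarith
    · have hshift := sub_lt_sub_shift_of_strictMonoOn_deriv hder hmono hx hyx
      rw [sub_add_cancel] at hshift
      by_cases he : y - x = z
      · rw [key, ← he]; linarith
      · linarith [tangent hz0.le hyx.le he]

theorem statement14
    (a q μp μm σp σm : ℝ)
    (ha : 0 < a) (hq : 0 < q) (hσp : 0 < σp) (hσm : 0 < σm)
    (θ1p θ2p θ1m θ2m cm cp : ℝ)
    (hθ1p : θ1p = (Real.sqrt (μp ^ 2 + 2 * q * σp ^ 2) + μp) / σp ^ 2)
    (hθ2p : θ2p = (Real.sqrt (μp ^ 2 + 2 * q * σp ^ 2) - μp) / σp ^ 2)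
    (hθ1m : θ1m = (Real.sqrt (μm ^ 2 + 2 * q * σm ^ 2) + μm) / σm ^ 2)
    (hθ2m : θ2m = (Real.sqrt (μm ^ 2 + 2 * q * σm ^ 2) - μm) / σm ^ 2)
    (hcm : cm = (θ1m - θ1p) / (θ2m + θ1m))
    (hcp : cp = (θ2p - θ2m) / (θ2p + θ1p))
    (gm gp g : ℝ → ℝ)
    (hgm : ∀ x, gm x = if a < x then Real.exp (-θ1p * (x - a))
      else cm * Real.exp (θ2m * (x - a)) + (1 - cm) * Real.exp (-θ1m * (x - a)))
    (hgp : ∀ x, gp x = if a < x then (1 - cp) * Real.exp (θ2p * (x - a)) + cp * Real.exp (-θ1p * (x - a))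
      else Real.exp (θ2m * (x - a)))
    (hg : ∀ x, g x = gp x * gm 0 - gm x * gp 0)
    (β : ℝ) (hβ : 0 < β)
    (Dζ : Set (ℝ × ℝ))
    (hD : Dζ = {p : ℝ × ℝ | 0 ≤ p.1 ∧ 0 ≤ p.2 ∧ p.1 + β ≤ p.2})
    (ζ : ℝ → ℝ → ℝ)
    (hζ : ∀ z₁ z₂, ζ z₁ z₂ = (z₂ - z₁ - β) / (g z₂ - g z₁))
    (Mζ : Set (ℝ × ℝ))
    (hM : Mζ = {p ∈ Dζ | ∀ p' ∈ Dζ, ζ p'.1 p'.2 ≤ ζ p.1 p.2})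
    (ψ : ℝ → ℝ → ℝ)
    (hψ : ∀ x y, ψ x y = ∫ s in x..y, (1 - deriv g s / deriv g y))
    (hμp : 0 < μp) (hμm : μm ≤ 0)
    (Θ : ℝ)
    (hΘ : Θ = cp * θ1p ^ 2 + (1 - cp) * θ2p ^ 2)
    (a₂ : ℝ)
    (ha₂ : a₂ = Real.log ((θ2p + θ1m) / (θ2p - θ2m)) / (θ1m + θ2m))
    (a₃ : ℝ)
    (ha₃ : a₃ = Real.log (((1 - cm * cp) * θ1p ^ 2 - (1 - cp) * cm * θ2p ^ 2) / ((1 - cm) * Θ)) / (θ1m + θ2m))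
    (hcase : (0 < cp ∧ a₂ ≤ a) ∨ (0 < cp ∧ 0 < a₃ ∧ a₃ ≤ a ∧ a ≤ a₂) ∨
      (cp ≤ 0 ∧ 0 < Θ ∧ a₃ ≤ a))
    :
    ∃ z₂ : ℝ, 0 < z₂ ∧ ψ 0 z₂ = β ∧ (∀ w : ℝ, 0 < w → ψ 0 w = β → w = z₂) ∧
      Mζ = {((0 : ℝ), z₂)} := by
  have root_pos {μ σ : ℝ} (hσ : 0 < σ) : |μ| < √(μ ^ 2 + 2 * q * σ ^ 2) := by
    rw [← sqrt_sq_eq_abs]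
    exact sqrt_lt_sqrt (sq_nonneg μ) (by linarith [show 0 < 2 * q * σ ^ 2 by positivity])
  have hp := abs_lt.1 (root_pos (μ := μp) hσp)
  have hm := abs_lt.1 (root_pos (μ := μm) hσm)
  have p1pos : 0 < θ1p := by rw [hθ1p]; exact div_pos (by linarith) (by positivity)
  have p2pos : 0 < θ2p := by rw [hθ2p]; exact div_pos (by linarith) (by positivity)
  have m1pos : 0 < θ1m := by rw [hθ1m]; exact div_pos (by linarith) (by positivity)
  have m1le : θ1m ≤ θ2m := by rw [hθ1m, hθ2m]; gcongr; linarith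
  clear hθ1p hθ2p hθ1m hθ2m hp hm root_pos
  have m2pos : 0 < θ2m := m1pos.trans_le m1le
  have spos : 0 < θ1m + θ2m := by positivity
  have hcm1 : 0 < 1 - cm := by
    rw [show 1 - cm = (θ2m + θ1p) / (θ2m + θ1m) by rw [hcm]; field_simp; ring]; positivity
  have hcp1 : 0 < 1 - cp := by
    rw [show 1 - cp = (θ1p + θ2m) / (θ2p + θ1p) by rw [hcp]; field_simp; ring]; positivity
  have hcm' : cm * (θ2m + θ1m) = θ1m - θ1p := by rw [hcm]; field_simp
  have hcp' : cp * (θ2p + θ1p) = θ2p - θ2m := by rw [hcp]; field_simp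
  set N := exp (-θ2m * a) with hN
  set E := exp (θ1m * a) with hE
  have Npos : 0 < N := exp_pos _
  have Epos : 0 < E := exp_pos _
  have hEN : E = N * exp ((θ1m + θ2m) * a) := by rw [hN, hE, ← exp_add]; congr 1; ring
  set A := cm * N + (1 - cm) * E with hA
  have hgm0 : gm 0 = A := by
    rw [hgm, if_neg ha.not_gt, hA, hN, hE]; congr 3 <;> ring_nf
  have hgp0 : gp 0 = N := by
    rw [hgp, if_neg ha.not_gt, hN]; ring_nf
  have S1 : 1 < exp ((θ1m + θ2m) * a) := one_lt_exp_iff.2 (by positivity)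
  have Apos : 0 < A := by
    rw [hA, hEN]
    nlinarith [mul_pos hcm1 (mul_pos Npos (sub_pos.2 S1))]
  have of_a₃ (hΘ0 : 0 < Θ) (h : a₃ ≤ a) : N * θ1p ^ 2 ≤ A * Θ := by
    rw [ha₃] at h
    have h := le_exp_mul_of_log_div_le spos h
    rw [div_le_iff₀ (by positivity)] at h
    have : θ1p ^ 2 ≤ (cm + (1 - cm) * exp ((θ1m + θ2m) * a)) * Θ := by
      linear_combination h - cm * hΘ
    rw [hA, hEN]
    linear_combination N * this
  have hconv : N * θ1p ^ 2 ≤ A * Θ := by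
    rcases hcase with ⟨hc, h⟩ | ⟨hc, -, h, -⟩ | ⟨-, hΘ0, h⟩
    · have hd : 0 < θ2p - θ2m := by rw [← hcp']; positivity
      rw [ha₂] at h
      have h := le_exp_mul_of_log_div_le spos h
      rw [div_le_iff₀ hd] at h
      have h1 : 1 ≤ (cm + (1 - cm) * exp ((θ1m + θ2m) * a)) * cp := by
        have e1 : 1 - cm * cp = (1 - cm) * (θ2p + θ1m) / (θ2p + θ1p) := by
          rw [hcm, hcp]; field_simp; ring
        have e2 : cp = (θ2p - θ2m) / (θ2p + θ1p) := hcp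
        have h2 : (1 - cm) * (θ2p + θ1m) / (θ2p + θ1p) ≤
            (1 - cm) * (exp ((θ1m + θ2m) * a) * (θ2p - θ2m)) / (θ2p + θ1p) := by
          gcongr
        have h3 : (1 - cm) * (exp ((θ1m + θ2m) * a) * (θ2p - θ2m)) / (θ2p + θ1p) =
            (1 - cm) * exp ((θ1m + θ2m) * a) * cp := by rw [e2]; ring
        linarith
      have h2 : N ≤ A * cp := by
        rw [hA, hEN]; linear_combination N * h1
      rw [hΘ]
      have h3 : 0 ≤ A * (1 - cp) * θ2p ^ 2 := by positivity
      linear_combination θ1p ^ 2 * h2 + h3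
    · exact of_a₃ (by rw [hΘ]; positivity) h
    · exact of_a₃ hΘ0 h
  set L : ℝ → ℝ := fun x => (1 - cm) * (E * exp (θ2m * (x - a)) - N * exp (-θ1m * (x - a))) with hL
  set R : ℝ → ℝ := fun x =>
    A * (1 - cp) * exp (θ2p * (x - a)) + (A * cp - N) * exp (-θ1p * (x - a)) with hR
  set L' : ℝ → ℝ := fun x =>
    (1 - cm) * (E * θ2m * exp (θ2m * (x - a)) + N * θ1m * exp (-θ1m * (x - a))) with hL'
  set R' : ℝ → ℝ := fun x =>
    A * (1 - cp) * θ2p * exp (θ2p * (x - a)) - (A * cp - N) * θ1p * exp (-θ1p * (x - a)) with hR'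
  have hgLR : g = fun x => if x ≤ a then L x else R x := by
    funext x
    rw [hg, hgm0, hgp0, hgp, hgm]
    rcases le_or_gt x a with hx | hx
    · simp only [if_pos hx, if_neg hx.not_gt, hL, hA]; ring
    · simp only [if_pos hx, if_neg hx.not_ge, hR]; ring
  have hLd (x : ℝ) : HasDerivAt L (L' x) x := by
    exact ((((hasDerivAt_exp_mul_sub θ2m a x).const_mul E).sub
      ((hasDerivAt_exp_mul_sub (-θ1m) a x).const_mul N)).const_mul (1 - cm)).congr_deriv
        (by simp only [hL']; ring)
  have hRd (x : ℝ) : HasDerivAt R (R' x) x := by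
    exact (((hasDerivAt_exp_mul_sub θ2p a x).const_mul (A * (1 - cp))).add
      ((hasDerivAt_exp_mul_sub (-θ1p) a x).const_mul (A * cp - N))).congr_deriv
        (by simp only [hR']; ring)
  have hLRa : L a = R a := by
    simp only [hL, hR, sub_self, mul_zero, exp_zero, hA]; ring
  have hLRa' : L' a = R' a := by
    simp only [hL', hR', sub_self, mul_zero, exp_zero]
    linear_combination A * hcp' - N * hcm' - θ2m * hA
  have hL'eq (x : ℝ) : L' x =
      (1 - cm) * E * N * (θ2m * exp (θ2m * x) - (-θ1m) * exp (-θ1m * x)) := by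
    have e1 : exp (θ2m * (x - a)) = N * exp (θ2m * x) := by rw [hN, ← exp_add]; congr 1; ring
    have e2 : exp (-θ1m * (x - a)) = E * exp (-θ1m * x) := by rw [hE, ← exp_add]; congr 1; ring
    simp only [hL', e1, e2]; ring
  have hL'mono : StrictMonoOn L' (Icc 0 a) := by
    have h := strictMonoOn_exp_sub_exp (v := -θ1m) m2pos m1pos m2pos (by nlinarith)
    intro x hx y hy hxy
    rw [hL'eq, hL'eq]
    exact mul_lt_mul_of_pos_left (h hx.1 hy.1 hxy) (by positivity)
  have hR'mono : StrictMonoOn R' (Ici a) := by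
    have h := strictMonoOn_exp_sub_exp (u := A * (1 - cp) * θ2p) (v := (A * cp - N) * θ1p)
      p2pos p1pos (by positivity) (by rw [hΘ] at hconv; linear_combination hconv)
    intro x hx y hy hxy
    exact h (mem_Ici.2 (sub_nonneg.2 hx)) (mem_Ici.2 (sub_nonneg.2 hy)) (sub_lt_sub_right hxy a)
  set h : ℝ → ℝ := fun x => if x ≤ a then L' x else R' x with hh
  have hder (x : ℝ) : HasDerivAt g (h x) x := by
    rw [hgLR]; exact hasDerivAt_ite_le hLd hRd hLRa hLRa' x
  have hmono : StrictMonoOn h (Ici 0) := strictMonoOn_ite_le ha.le hL'mono hR'mono hLRa'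
  have hcont : Continuous h := by
    refine Continuous.if_le (by fun_prop) (by fun_prop) continuous_id continuous_const ?_
    rintro x rfl
    exact hLRa'
  have h0 : 0 < h 0 := by
    simp only [hh, if_pos ha.le, hL']; positivity
  have htop : Tendsto h atTop atTop := by
    have hlin : Tendsto (fun x : ℝ => x - a) atTop atTop := tendsto_atTop_add_const_right _ _ tendsto_id
    have t1 : Tendsto (fun x => A * (1 - cp) * θ2p * exp (θ2p * (x - a))) atTop atTop :=
      (tendsto_exp_atTop.comp (hlin.const_mul_atTop p2pos)).const_mul_atTop (by positivity)
    have t2 : Tendsto (fun x => -((A * cp - N) * θ1p * exp (-θ1p * (x - a)))) atTop (nhds 0) := by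
      have := ((tendsto_exp_atBot.comp (hlin.const_mul_atTop_of_neg (neg_lt_zero.2 p1pos))).const_mul
        ((A * cp - N) * θ1p)).neg
      simpa using this
    refine (t1.atTop_add t2).congr' ?_
    filter_upwards [eventually_gt_atTop a] with x hx
    simp only [hh, if_neg hx.not_ge, hR', sub_eq_add_neg]
  have hpos {x : ℝ} (hx : 0 ≤ x) : 0 < h x := h0.trans_le (hmono.monotoneOn self_mem_Ici hx hx)
  obtain ⟨z, hβz, hz, huniq, hmax⟩ := exists_unique_tangent_point hder hmono hcont h0 htop hβ
  have hψ_iff {w : ℝ} (hw : 0 < w) : ψ 0 w = β ↔ g w - g 0 = h w * (w - β) := by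
    have hderiv : deriv g = h := funext fun x => (hder x).deriv
    have hw' := (hpos hw.le).ne'
    rw [hψ, hderiv, intervalIntegral.integral_eq_sub_of_hasDerivAt (f := fun s => s - g s / h w)
      (fun s _ => (hasDerivAt_id s).sub ((hder s).div_const _))
      (Continuous.intervalIntegrable (by fun_prop) _ _)]
    constructor
    · intro he
      field_simp at he
      linarith
    · intro he
      field_simp
      linarith
  have hz0 : 0 < z := hβ.trans hβz
  have hζz : ζ 0 z = 1 / h z := by
    have := hpos hz0.le
    have : z - β ≠ 0 := by linarith
    rw [hζ, hz, sub_zero]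
    field_simp
  have hζlt {x y : ℝ} (hx : 0 ≤ x) (hxy : x + β ≤ y) (hne : (x, y) ≠ (0, z)) :
      ζ x y < 1 / h z := by
    have h1 := hmax x y hx hxy hne
    have h2 : 0 ≤ h z * (y - x - β) := mul_nonneg (hpos hz0.le).le (by linarith)
    rw [hζ, div_lt_div_iff₀ (h2.trans_lt h1) (hpos hz0.le)]
    linarith
  have hzD : ((0 : ℝ), z) ∈ Dζ := by
    rw [hD]; exact ⟨le_rfl, hz0.le, by simpa using hβz.le⟩
  refine ⟨z, hz0, (hψ_iff hz0).2 hz, fun w hw he => huniq w hw ((hψ_iff hw).1 he), ?_⟩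
  rw [hM]
  ext ⟨x, y⟩
  simp only [mem_ofPred_eq, mem_singleton_iff]
  constructor
  · rintro ⟨hmem, hle⟩
    by_contra hne
    have h1 := hle _ hzD
    rw [hD] at hmem
    have h2 := hζlt hmem.1 hmem.2.2 hne
    rw [hζz] at h1
    exact h1.not_gt h2
  · rintro ⟨rfl, rfl⟩
    refine ⟨hzD, ?_⟩
    rintro ⟨u, v⟩ hmem
    rw [hζz]
    by_cases hne : (u, v) = (0, z)
    · rw [hne, hζz]
    · rw [hD] at hmem
      exact (hζlt hmem.1 hmem.2.2 hne).le
end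

section
/- Regarding the maximizer set M_ζ(β) as a function of the transaction-cost parameter β > 0 (all other parameters fixed), the maximum of z₂ − z₁ over (z₁,z₂) ∈ M_ζ(β) tends to 0 as β → 0⁺; here for each β > 0 the maximum is attained because M_ζ(β) is a nonempty compact subset of ℝ². -/
open Real Set Filter

/-- The pairs `(x, y)` with `0 ≤ x` and `x + δ ≤ y`. -/
def gapSet (δ : ℝ) : Set (ℝ × ℝ) := {p | 0 ≤ p.1 ∧ p.1 + δ ≤ p.2}

/-- The reciprocal chord slope of `g`, with the length of the chord reduced by `β`. -/
noncomputable def reducedRatio (g : ℝ → ℝ) (β : ℝ) (p : ℝ × ℝ) : ℝ :=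
  (p.2 - p.1 - β) / (g p.2 - g p.1)

/-- The chord slopes of `g` between nonnegative points tend to infinity with the right endpoint. -/
def ChordCoercive (g : ℝ → ℝ) : Prop :=
  ∀ K : ℝ, ∃ R : ℝ, ∀ x y : ℝ, 0 ≤ x → x < y → R ≤ y → K * (y - x) ≤ g y - g x

theorem isCompact_superlevel_reducedRatio {g : ℝ → ℝ} (hc : Continuous g) (hm : StrictMono g)
    (hK : ChordCoercive g) {β δ c : ℝ} (hβ : 0 ≤ β) (hδ : 0 < δ) (h0 : 0 < c) :
    IsCompact {p ∈ gapSet δ | c ≤ reducedRatio g β p} := by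
  obtain ⟨R, hR⟩ := hK (2 / c)
  have hclosed : IsClosed (gapSet δ) :=
    (isClosed_le continuous_const continuous_fst).inter
      (isClosed_le (by fun_prop) continuous_snd)
  have hcont : ContinuousOn (reducedRatio g β) (gapSet δ) := by
    unfold reducedRatio
    refine ContinuousOn.div (by fun_prop) (by fun_prop) ?_
    rintro ⟨x, y⟩ ⟨_, h2⟩
    have := hm (show x < y by simp only at h2; linarith)
    simp only
    linarith
  have hcl : IsClosed {p ∈ gapSet δ | c ≤ reducedRatio g β p} :=
    hcont.preimage_isClosed_of_isClosed hclosed isClosed_Ici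
  refine (isCompact_Icc (a := ((0, 0) : ℝ × ℝ)) (b := (R, R))).of_isClosed_subset hcl ?_
  rintro ⟨x, y⟩ ⟨⟨h1, h2⟩, h3⟩
  simp only [reducedRatio] at h1 h2 h3
  have hxy : x < y := by linarith
  have hg := hm hxy
  have hyR : y ≤ R := by
    by_contra! hlt
    have h4 := hR x y h1 hxy hlt.le
    rw [le_div_iff₀ (by linarith)] at h3
    have h5 := mul_le_mul_of_nonneg_left h4 h0.le
    have h6 : c * (2 / c * (y - x)) = 2 * (y - x) := by field_simp
    linarith
  exact ⟨⟨h1, by simp only; linarith⟩, ⟨by simp only; linarith, hyR⟩⟩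

theorem exists_max_reducedRatio {g : ℝ → ℝ} (hc : Continuous g) (hm : StrictMono g)
    (hK : ChordCoercive g) {β δ : ℝ} (hβ : 0 ≤ β) (hδ : 0 < δ) (hβδ : β ≤ δ) :
    ∃ p ∈ gapSet δ, 0 < reducedRatio g β p ∧
      ∀ p' ∈ gapSet δ, reducedRatio g β p' ≤ reducedRatio g β p := by
  have hmem : ((0, 2 * δ) : ℝ × ℝ) ∈ gapSet δ := ⟨le_rfl, by simp only; linarith⟩
  have hpos : 0 < reducedRatio g β (0, 2 * δ) := by
    have := hm (show (0 : ℝ) < 2 * δ by linarith)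
    exact div_pos (by simp only; linarith) (by simp only; linarith)
  have hcpt := isCompact_superlevel_reducedRatio hc hm hK hβ hδ hpos
  have hcont : ContinuousOn (reducedRatio g β)
      {p ∈ gapSet δ | reducedRatio g β (0, 2 * δ) ≤ reducedRatio g β p} := by
    unfold reducedRatio
    refine ContinuousOn.div (by fun_prop) (by fun_prop) ?_
    rintro ⟨x, y⟩ ⟨⟨_, h2⟩, _⟩
    have := hm (show x < y by simp only at h2; linarith)
    simp only
    linarith
  obtain ⟨p, hp, hmax⟩ := hcpt.exists_isMaxOn ⟨_, hmem, le_rfl⟩ hcont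
  refine ⟨p, hp.1, hpos.trans_le hp.2, fun p' hp' => ?_⟩
  rcases le_total (reducedRatio g β (0, 2 * δ)) (reducedRatio g β p') with h | h
  · exact hmax ⟨hp', h⟩
  · exact h.trans hp.2

/-- If `g` is not affine on `[x, y]`, some subinterval has a strictly smaller chord slope. -/
theorem exists_chord_ratio_gt {g : ℝ → ℝ} (hm : StrictMono g) {x y : ℝ}
    (hna : ∃ z ∈ Ioo x y, (g z - g x) * (y - x) ≠ (z - x) * (g y - g x)) :
    ∃ u v : ℝ, x ≤ u ∧ u < v ∧ (y - x) / (g y - g x) < (v - u) / (g v - g u) := by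
  obtain ⟨z, ⟨hxz, hzy⟩, hne⟩ := hna
  have h1 := hm hxz
  have h2 := hm hzy
  rcases lt_or_gt_of_ne hne with h | h
  · refine ⟨x, z, le_rfl, hxz, ?_⟩
    rw [div_lt_div_iff₀ (by linarith) (by linarith)]
    linarith
  · refine ⟨z, y, hxz.le, hzy, ?_⟩
    rw [div_lt_div_iff₀ (by linarith) (by linarith)]
    linarith

/-- Maximizers of the reduced ratio have small gaps when the reduction is small. -/
theorem eventually_gap_lt_of_max {g : ℝ → ℝ} (hc : Continuous g) (hm : StrictMono g)
    (hK : ChordCoercive g)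
    (hna : ∀ x y : ℝ, x < y → ∃ z ∈ Ioo x y, (g z - g x) * (y - x) ≠ (z - x) * (g y - g x))
    {δ : ℝ} (hδ : 0 < δ) :
    ∀ᶠ β in nhdsWithin (0 : ℝ) (Ioi 0), ∀ p ∈ gapSet β,
      (∀ p' ∈ gapSet β, reducedRatio g β p' ≤ reducedRatio g β p) → p.2 - p.1 < δ := by
  obtain ⟨⟨x, y⟩, hp, -, hmax⟩ := exists_max_reducedRatio hc hm hK le_rfl hδ hδ.le
  have hp1 : 0 ≤ x := hp.1
  have hp2 : x + δ ≤ y := hp.2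
  obtain ⟨u, v, hxu, huv, hlt⟩ := exists_chord_ratio_gt hm (hna x y (by linarith))
  have hlim : Tendsto (fun β : ℝ => (v - u - β) / (g v - g u)) (nhdsWithin 0 (Ioi 0))
      (nhds ((v - u) / (g v - g u))) := by
    have h : Continuous fun β : ℝ => (v - u - β) / (g v - g u) := by fun_prop
    simpa using (h.tendsto 0).mono_left nhdsWithin_le_nhds
  have hsmall : ∀ᶠ β in nhdsWithin (0 : ℝ) (Ioi 0), β < v - u :=
    nhdsWithin_le_nhds (eventually_lt_nhds (by linarith))
  filter_upwards [hlim.eventually_const_lt hlt, hsmall, self_mem_nhdsWithin]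
    with β hβ1 hβ2 hβ0 p hpD hpmax
  have hβ0 : 0 < β := hβ0
  by_contra! hge
  have h1 : reducedRatio g β (u, v) ≤ reducedRatio g β p :=
    hpmax (u, v) ⟨by simp only; linarith, by simp only; linarith⟩
  have h2 : reducedRatio g 0 p ≤ reducedRatio g 0 (x, y) := hmax p ⟨hpD.1, by linarith⟩
  have h3 : reducedRatio g β p ≤ reducedRatio g 0 p := by
    have := hm (show p.1 < p.2 by linarith)
    unfold reducedRatio
    gcongr
  simp only [reducedRatio, sub_zero] at h1 h2 h3
  linarith

theorem strictMonoOn_add_exp {A B p r : ℝ} (hA : 0 ≤ A) (hp : 0 < p) (hr : 0 < r)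
    (h : 0 < A * p - B * r) :
    StrictMonoOn (fun x => A * exp (p * x) + B * exp (-r * x)) (Ici 0) := by
  refine strictMonoOn_of_deriv_pos (convex_Ici 0) (by fun_prop) fun x hx => ?_
  rw [interior_Ici] at hx
  have hx : 0 < x := hx
  have hd : HasDerivAt (fun x => A * exp (p * x) + B * exp (-r * x))
      (A * (exp (p * x) * p) + B * (exp (-r * x) * -r)) x := by
    have h1 : HasDerivAt (fun x : ℝ => p * x) p x := by simpa using (hasDerivAt_id x).const_mul p
    have h2 : HasDerivAt (fun x : ℝ => -r * x) (-r) x := by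
      simpa using (hasDerivAt_id x).const_mul (-r)
    exact (h1.exp.const_mul A).add (h2.exp.const_mul B)
  rw [hd.deriv]
  have h1 : exp (-r * x) ≤ exp (p * x) := exp_le_exp.2 (by nlinarith)
  have h2 := mul_le_mul_of_nonneg_left h1 (mul_nonneg hA hp.le)
  have h3 := mul_pos h (exp_pos (-r * x))
  linarith

/-- A combination of a growing and a decaying exponential that is affine at four equally spaced
points has zero coefficients. -/
theorem coeff_eq_zero_of_add_exp_affine {A B p r s h k d : ℝ} (hp : 0 < p) (hr : 0 < r)
    (hh : 0 < h)
    (haff : ∀ i : ℕ, i ≤ 3 → A * exp (p * (s + i * h)) + B * exp (-r * (s + i * h)) = k + i * d) :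
    A = 0 ∧ B = 0 := by
  have hu : 1 < exp (p * h) := one_lt_exp_iff.2 (by positivity)
  have hv : exp (-r * h) < 1 := exp_lt_one_iff.2 (by nlinarith)
  have e1 : ∀ c : ℝ, ∀ i : ℕ, exp (c * (s + i * h)) = exp (c * s) * exp (c * h) ^ i := by
    intro c i
    rw [← exp_nat_mul, ← exp_add]
    ring_nf
  have h0 := haff 0 (by norm_num)
  have h1 := haff 1 (by norm_num)
  have h2 := haff 2 (by norm_num)
  have h3 := haff 3 (by norm_num)
  rw [e1, e1] at h0 h1 h2 h3
  have hP := exp_pos (p * s)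
  have hQ := exp_pos (-r * s)
  generalize exp (p * h) = u at *
  generalize exp (-r * h) = v at *
  generalize exp (p * s) = P at *
  generalize exp (-r * s) = Q at *
  push_cast at h0 h1 h2 h3
  have hA : A * (P * (u - 1) ^ 2 * (u - v)) = 0 := by
    linear_combination h3 - 2 * h2 + h1 - v * (h2 - 2 * h1 + h0)
  have hB : B * (Q * (v - 1) ^ 2 * (v - u)) = 0 := by
    linear_combination h3 - 2 * h2 + h1 - u * (h2 - 2 * h1 + h0)
  have n1 : u - 1 ≠ 0 := by linarith
  have n2 : v - 1 ≠ 0 := by linarith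
  have n3 : u - v ≠ 0 := by linarith
  have n4 : v - u ≠ 0 := by linarith
  constructor
  · exact (mul_eq_zero.1 hA).resolve_right (by positivity)
  · exact (mul_eq_zero.1 hB).resolve_right (by positivity)

/-- A function given by nontrivial exponential combinations on both sides of `a` is not affine on
any interval. -/
theorem not_affine_of_piecewise_exp {g : ℝ → ℝ} {a A B C D p r p' r' : ℝ} (hp : 0 < p)
    (hr : 0 < r) (hp' : 0 < p') (hr' : 0 < r') (hA : A ≠ 0) (hD : D ≠ 0)
    (hge : ∀ x, a ≤ x → g x = A * exp (p * (x - a)) + B * exp (-r * (x - a)))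
    (hle : ∀ x, x ≤ a → g x = C * exp (p' * (x - a)) + D * exp (-r' * (x - a)))
    (x y : ℝ) (hxy : x < y) :
    ∃ z ∈ Ioo x y, (g z - g x) * (y - x) ≠ (z - x) * (g y - g x) := by
  by_contra! hall
  have haff : ∀ z, x ≤ z → z ≤ y → g z = g x + (z - x) * ((g y - g x) / (y - x)) := by
    intro z h1 h2
    have hne : y - x ≠ 0 := by linarith
    have key : (g z - g x) * (y - x) = (z - x) * (g y - g x) := by
      rcases h1.eq_or_lt with rfl | h1
      · ring
      rcases h2.eq_or_lt with rfl | h2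
      · ring
      exact hall z ⟨h1, h2⟩
    field_simp
    linear_combination key
  have hstep : ∀ w h : ℝ, x ≤ w → 0 < h → w + 3 * h ≤ y → ∀ i : ℕ, i ≤ 3 →
      g (w + i * h) = g w + i * (h * ((g y - g x) / (y - x))) := by
    intro w h h1 h2 h3 i hi
    have hi' : (i : ℝ) ≤ 3 := by exact_mod_cast hi
    have hi0 : (0 : ℝ) ≤ i := i.cast_nonneg
    rw [haff (w + i * h) (by nlinarith) (by nlinarith), haff w h1 (by linarith)]
    ring
  rcases le_or_gt a x with hax | hxa
  · have h3 : 0 < (y - x) / 3 := by linarith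
    refine hA (coeff_eq_zero_of_add_exp_affine (A := A) (B := B) (s := x - a) (k := g x)
      (d := (y - x) / 3 * ((g y - g x) / (y - x))) hp hr h3 fun i hi => ?_).1
    rw [← hstep x _ le_rfl h3 (by linarith) i hi, hge _ (by nlinarith [i.cast_nonneg (α := ℝ)])]
    ring_nf
  · have h3 : 0 < (min y a - x) / 3 := by
      have := lt_min hxy hxa
      linarith
    have hy := min_le_left y a
    have ha := min_le_right y a
    refine hD (coeff_eq_zero_of_add_exp_affine (A := C) (B := D) (s := x - a) (k := g x)
      (d := (min y a - x) / 3 * ((g y - g x) / (y - x))) hp' hr' h3 fun i hi => ?_).2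
    have hi' : (i : ℝ) ≤ 3 := by exact_mod_cast hi
    rw [← hstep x _ le_rfl h3 (by linarith) i hi, hle _ (by nlinarith)]
    ring_nf

theorem chordCoercive_of_eventually_exp {g : ℝ → ℝ} (hm : StrictMono g) {a A B p r : ℝ}
    (hp : 0 < p) (hr : 0 < r) (hA : 0 < A)
    (hge : ∀ x, a ≤ x → g x = A * exp (p * (x - a)) + B * exp (-r * (x - a))) :
    ChordCoercive g := by
  have hloc : ∀ s t : ℝ, a ≤ s → s ≤ t →
      (A * p * exp (p * (s - a)) - |B| * r) * (t - s) ≤ g t - g s := by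
    intro s t hs hst
    rw [hge s hs, hge t (hs.trans hst)]
    have e1 : exp (p * (t - a)) = exp (p * (s - a)) * exp (p * (t - s)) := by
      rw [← exp_add]; ring_nf
    have e2 : exp (-r * (t - a)) = exp (-r * (s - a)) * exp (-r * (t - s)) := by
      rw [← exp_add]; ring_nf
    have h1 := add_one_le_exp (p * (t - s))
    have h2 := add_one_le_exp (-r * (t - s))
    have h3 : exp (-r * (s - a)) ≤ 1 := exp_le_one_iff.2 (by nlinarith)
    have h4 : exp (-r * (t - s)) ≤ 1 := exp_le_one_iff.2 (by nlinarith)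
    have h5 := exp_pos (-r * (s - a))
    have h6 := mul_le_mul_of_nonneg_left h1 (mul_pos hA (exp_pos (p * (s - a)))).le
    have h7 : exp (-r * (s - a)) * (1 - exp (-r * (t - s))) ≤ r * (t - s) := by
      nlinarith
    have h8 : 0 ≤ exp (-r * (s - a)) * (1 - exp (-r * (t - s))) :=
      mul_nonneg h5.le (by linarith)
    have h9 : B * (exp (-r * (s - a)) * (1 - exp (-r * (t - s)))) ≤ |B| * (r * (t - s)) :=
      (mul_le_mul_of_nonneg_right (le_abs_self B) h8).trans
        (mul_le_mul_of_nonneg_left h7 (abs_nonneg B))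
    rw [e1, e2]
    linarith
  intro K
  have hlim : Tendsto (fun s : ℝ => A * p * exp (p * (s - a)) - |B| * r) atTop atTop := by
    refine tendsto_atTop_add_const_right _ _ (Tendsto.const_mul_atTop (by positivity) ?_)
    exact tendsto_exp_atTop.comp
      ((tendsto_atTop_add_const_right _ (-a) tendsto_id).const_mul_atTop hp)
  obtain ⟨S, hS⟩ := eventually_atTop.1 (hlim.eventually_ge_atTop (2 * |K|))
  refine ⟨2 * max S a, fun x y hx hxy hy => ?_⟩
  have hSa := le_max_left S a
  have haS := le_max_right S a
  have hw : y / 2 ≤ max x (y / 2) := le_max_right _ _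
  have hwx : x ≤ max x (y / 2) := le_max_left _ _
  have hwy : max x (y / 2) ≤ y := max_le hxy.le (by linarith)
  have hlen : y - x ≤ 2 * (y - max x (y / 2)) := by
    rcases max_cases x (y / 2) with h | h <;> linarith
  have h1 := hloc _ y (show a ≤ max x (y / 2) by linarith) hwy
  have h2 := mul_le_mul_of_nonneg_right (hS (max x (y / 2)) (by linarith)) (sub_nonneg.2 hwy)
  have h3 := hm.monotone hwx
  have h4 := mul_le_mul_of_nonneg_left hlen (abs_nonneg K)
  have h5 := mul_le_mul_of_nonneg_right (le_abs_self K) (sub_nonneg.2 hxy.le)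
  linarith

theorem root_pair_pos {q μ σ : ℝ} (hq : 0 < q) (hσ : 0 < σ) :
    0 < (√(μ ^ 2 + 2 * q * σ ^ 2) + μ) / σ ^ 2 ∧ 0 < (√(μ ^ 2 + 2 * q * σ ^ 2) - μ) / σ ^ 2 := by
  have h : |μ| < √(μ ^ 2 + 2 * q * σ ^ 2) := by
    rw [← sqrt_sq_eq_abs]
    exact sqrt_lt_sqrt (sq_nonneg μ) (by linarith [show 0 < 2 * q * σ ^ 2 by positivity])
  obtain ⟨h1, h2⟩ := abs_lt.1 h
  exact ⟨div_pos (by linarith) (by positivity), div_pos (by linarith) (by positivity)⟩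

theorem statement15
    (a q μp μm σp σm : ℝ)
    (ha : 0 < a) (hq : 0 < q) (hσp : 0 < σp) (hσm : 0 < σm)
    (θ1p θ2p θ1m θ2m cm cp : ℝ)
    (hθ1p : θ1p = (Real.sqrt (μp ^ 2 + 2 * q * σp ^ 2) + μp) / σp ^ 2)
    (hθ2p : θ2p = (Real.sqrt (μp ^ 2 + 2 * q * σp ^ 2) - μp) / σp ^ 2)
    (hθ1m : θ1m = (Real.sqrt (μm ^ 2 + 2 * q * σm ^ 2) + μm) / σm ^ 2)
    (hθ2m : θ2m = (Real.sqrt (μm ^ 2 + 2 * q * σm ^ 2) - μm) / σm ^ 2)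
    (hcm : cm = (θ1m - θ1p) / (θ2m + θ1m))
    (hcp : cp = (θ2p - θ2m) / (θ2p + θ1p))
    (gm gp g : ℝ → ℝ)
    (hgm : ∀ x, gm x = if a < x then Real.exp (-θ1p * (x - a))
      else cm * Real.exp (θ2m * (x - a)) + (1 - cm) * Real.exp (-θ1m * (x - a)))
    (hgp : ∀ x, gp x = if a < x then (1 - cp) * Real.exp (θ2p * (x - a)) + cp * Real.exp (-θ1p * (x - a))
      else Real.exp (θ2m * (x - a)))
    (hg : ∀ x, g x = gp x * gm 0 - gm x * gp 0)
    (Dζ : ℝ → Set (ℝ × ℝ))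
    (hD : ∀ β : ℝ, Dζ β = {p : ℝ × ℝ | 0 ≤ p.1 ∧ 0 ≤ p.2 ∧ p.1 + β ≤ p.2})
    (ζ : ℝ → ℝ → ℝ → ℝ)
    (hζ : ∀ β z₁ z₂ : ℝ, ζ β z₁ z₂ = (z₂ - z₁ - β) / (g z₂ - g z₁))
    (Mζ : ℝ → Set (ℝ × ℝ))
    (hM : ∀ β : ℝ, Mζ β = {p ∈ Dζ β | ∀ p' ∈ Dζ β, ζ β p'.1 p'.2 ≤ ζ β p.1 p.2})
    :
    (∀ β : ℝ, 0 < β → (Mζ β).Nonempty ∧ IsCompact (Mζ β)) ∧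
      Filter.Tendsto (fun β : ℝ => sSup ((fun p : ℝ × ℝ => p.2 - p.1) '' Mζ β))
        (nhdsWithin 0 (Set.Ioi 0)) (nhds 0) := by
  obtain ⟨p1p, p2p⟩ := root_pair_pos (μ := μp) hq hσp
  obtain ⟨p1m, p2m⟩ := root_pair_pos (μ := μm) hq hσm
  rw [← hθ1p] at p1p
  rw [← hθ2p] at p2p
  rw [← hθ1m] at p1m
  rw [← hθ2m] at p2m
  have hcm1 : cm * (θ2m + θ1m) = θ1m - θ1p := by
    rw [hcm]; field_simp
  have hcp1 : cp * (θ2p + θ1p) = θ2p - θ2m := by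
    rw [hcp]; field_simp
  have hcm2 : 0 < 1 - cm := by
    rw [hcm, sub_pos, div_lt_one (by positivity)]; linarith
  have hcp2 : 0 < 1 - cp := by
    rw [hcp, sub_pos, div_lt_one (by positivity)]; linarith
  have hgm_ge : ∀ x, a ≤ x → gm x = exp (-θ1p * (x - a)) := by
    intro x hx
    rcases hx.eq_or_lt with rfl | hx
    · simp [hgm]
    · rw [hgm, if_pos hx]
  have hgm_le : ∀ x, x ≤ a →
      gm x = cm * exp (θ2m * (x - a)) + (1 - cm) * exp (-θ1m * (x - a)) :=
    fun x hx => by rw [hgm, if_neg hx.not_gt]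
  have hgp_ge : ∀ x, a ≤ x →
      gp x = (1 - cp) * exp (θ2p * (x - a)) + cp * exp (-θ1p * (x - a)) := by
    intro x hx
    rcases hx.eq_or_lt with rfl | hx
    · simp [hgp]
    · rw [hgp, if_pos hx]
  have hgp_le : ∀ x, x ≤ a → gp x = exp (θ2m * (x - a)) :=
    fun x hx => by rw [hgp, if_neg hx.not_gt]
  have hgp_mono : StrictMono gp := by
    refine StrictMonoOn.Iic_union_Ici (a := a) ?_ ?_
    · intro x hx y hy hxy
      rw [hgp_le x hx, hgp_le y hy]
      exact exp_lt_exp.2 (by nlinarith)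
    · intro x hx y hy hxy
      rw [hgp_ge x hx, hgp_ge y hy]
      exact strictMonoOn_add_exp (A := 1 - cp) (B := cp) hcp2.le p2p p1p (by linarith)
        (show x - a ∈ Ici 0 from mem_Ici.2 (sub_nonneg.2 hx))
        (show y - a ∈ Ici 0 from mem_Ici.2 (sub_nonneg.2 hy))
        (by linarith)
  have hgm_anti : StrictAnti gm := by
    refine StrictAntiOn.Iic_union_Ici (a := a) ?_ ?_
    · intro x hx y hy hxy
      rw [hgm_le x hx, hgm_le y hy]
      have h := strictMonoOn_add_exp (A := 1 - cm) (B := cm) hcm2.le p1m p2m (by linarith)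
        (show a - y ∈ Ici 0 from mem_Ici.2 (sub_nonneg.2 hy))
        (show a - x ∈ Ici 0 from mem_Ici.2 (sub_nonneg.2 hx))
        (by linarith)
      have e : ∀ c z : ℝ, c * (a - z) = -c * (z - a) := fun c z => by ring
      simp only [e, neg_neg] at h
      linarith
    · intro x hx y hy hxy
      rw [hgm_ge x hx, hgm_ge y hy]
      exact exp_lt_exp.2 (by nlinarith)
  have hgm0 : 0 < gm 0 := by
    have h1 := hgm_anti ha
    rw [hgm_ge a le_rfl] at h1
    exact (exp_pos _).trans h1
  have hgp0 : 0 < gp 0 := by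
    rw [hgp_le 0 ha.le]
    exact exp_pos _
  have hgm_cont : Continuous gm := by
    have : gm = fun x => if x ≤ a then
        cm * exp (θ2m * (x - a)) + (1 - cm) * exp (-θ1m * (x - a)) else exp (-θ1p * (x - a)) := by
      ext x
      split_ifs with h
      · exact hgm_le x h
      · exact hgm_ge x (not_le.1 h).le
    rw [this]
    exact Continuous.if_le (by fun_prop) (by fun_prop) continuous_id continuous_const
      fun x hx => by simp [hx]
  have hgp_cont : Continuous gp := by
    have : gp = fun x => if x ≤ a then exp (θ2m * (x - a)) else
        (1 - cp) * exp (θ2p * (x - a)) + cp * exp (-θ1p * (x - a)) := by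
      ext x
      split_ifs with h
      · exact hgp_le x h
      · exact hgp_ge x (not_le.1 h).le
    rw [this]
    exact Continuous.if_le (by fun_prop) (by fun_prop) continuous_id continuous_const
      fun x hx => by simp [hx]
  have hc : Continuous g := by
    rw [funext hg]
    fun_prop
  have hm : StrictMono g := by
    intro x y hxy
    rw [hg, hg]
    have h1 := mul_lt_mul_of_pos_right (hgp_mono hxy) hgm0
    have h2 := mul_lt_mul_of_pos_right (hgm_anti hxy) hgp0
    linarith
  have hg_ge : ∀ x, a ≤ x → g x = ((1 - cp) * gm 0) * exp (θ2p * (x - a)) +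
      (cp * gm 0 - gp 0) * exp (-θ1p * (x - a)) := by
    intro x hx
    rw [hg, hgp_ge x hx, hgm_ge x hx]
    ring
  have hg_le : ∀ x, x ≤ a → g x = (gm 0 - cm * gp 0) * exp (θ2m * (x - a)) +
      (-((1 - cm) * gp 0)) * exp (-θ1m * (x - a)) := by
    intro x hx
    rw [hg, hgp_le x hx, hgm_le x hx]
    ring
  have hA : 0 < (1 - cp) * gm 0 := mul_pos hcp2 hgm0
  have hK : ChordCoercive g := chordCoercive_of_eventually_exp hm p2p p1p hA hg_ge
  have hna := not_affine_of_piecewise_exp p2p p1p p2m p1m hA.ne'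
    (neg_ne_zero.2 (mul_pos hcm2 hgp0).ne') hg_ge hg_le
  have hMmem : ∀ β : ℝ, 0 < β → ∀ p : ℝ × ℝ, p ∈ Mζ β ↔ p ∈ gapSet β ∧
      ∀ p' ∈ gapSet β, reducedRatio g β p' ≤ reducedRatio g β p := by
    intro β hβ p
    have hDeq : Dζ β = gapSet β := by
      rw [hD]
      ext ⟨x, y⟩
      simp only [gapSet, mem_ofPred_eq]
      exact ⟨fun h => ⟨h.1, h.2.2⟩, fun h => ⟨h.1, by linarith [h.1, h.2], h.2⟩⟩
    simp only [hM, hDeq, hζ, mem_ofPred_eq, reducedRatio]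
  have hfirst : ∀ β : ℝ, 0 < β → (Mζ β).Nonempty ∧ IsCompact (Mζ β) := by
    intro β hβ
    obtain ⟨p, hp, hpos, hmax⟩ := exists_max_reducedRatio hc hm hK hβ.le hβ le_rfl
    refine ⟨⟨p, (hMmem β hβ p).2 ⟨hp, hmax⟩⟩, ?_⟩
    convert isCompact_superlevel_reducedRatio hc hm hK hβ.le hβ hpos using 1
    ext p'
    rw [hMmem β hβ]
    exact ⟨fun h => ⟨h.1, h.2 p hp⟩, fun h => ⟨h.1, fun p'' hp'' => (hmax p'' hp'').trans h.2⟩⟩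
  refine ⟨hfirst, Metric.tendsto_nhds.2 fun ε hε => ?_⟩
  filter_upwards [eventually_gap_lt_of_max hc hm hK hna (half_pos hε), self_mem_nhdsWithin]
    with β hβ hβ0
  have hβ0 : 0 < β := hβ0
  have hnonneg : 0 ≤ sSup ((fun p : ℝ × ℝ => p.2 - p.1) '' Mζ β) := by
    refine Real.sSup_nonneg ?_
    rintro _ ⟨p, hp, rfl⟩
    have := ((hMmem β hβ0 p).1 hp).1.2
    simp only
    linarith
  have hle : sSup ((fun p : ℝ × ℝ => p.2 - p.1) '' Mζ β) ≤ ε / 2 := by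
    refine csSup_le ((hfirst β hβ0).1.image _) ?_
    rintro _ ⟨p, hp, rfl⟩
    obtain ⟨h1, h2⟩ := (hMmem β hβ0 p).1 hp
    exact (hβ p h1 h2).le
  rw [Real.dist_eq, sub_zero, abs_of_nonneg hnonneg]
  linarith
end

section
/- Regarding the maximizer set M_ζ(β) as a function of the transaction-cost parameter β > 0 (all other parameters fixed), both β ↦ max{z₂ − z₁ : (z₁,z₂) ∈ M_ζ(β)} and β ↦ min{z₂ − z₁ : (z₁,z₂) ∈ M_ζ(β)} are nondecreasing functions on (0,∞); here the maximum and minimum are attained because M_ζ(β) is a nonempty compact subset of ℝ². -/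
open Real Set Filter

/-- A map whose difference quotients blow up at infinity: every slope `K` is eventually exceeded. -/
def SlopeTendsToTop (g : ℝ → ℝ) : Prop :=
  ∀ K : ℝ, ∃ R : ℝ, ∀ u v : ℝ, R ≤ u → u ≤ v → K * (v - u) ≤ g v - g u

/-- The set of maximizers of `(z₂ - z₁ - β) / (g z₂ - g z₁)` over `0 ≤ z₁`, `z₁ + β ≤ z₂`. -/
def ratioArgmax (g : ℝ → ℝ) (β : ℝ) : Set (ℝ × ℝ) :=
  {p ∈ {p : ℝ × ℝ | 0 ≤ p.1 ∧ 0 ≤ p.2 ∧ p.1 + β ≤ p.2} |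
    ∀ p' ∈ {p : ℝ × ℝ | 0 ≤ p.1 ∧ 0 ≤ p.2 ∧ p.1 + β ≤ p.2},
      (p'.2 - p'.1 - β) / (g p'.2 - g p'.1) ≤ (p.2 - p.1 - β) / (g p.2 - g p.1)}

lemma StrictMono.exists_ratio_lt {g : ℝ → ℝ} (hg : StrictMono g) (htail : SlopeTendsToTop g)
    {β ε : ℝ} (hβ : 0 < β) (hε : 0 < ε) :
    ∃ R : ℝ, ∀ x y : ℝ, 0 ≤ x → x + β ≤ y → R ≤ y → (y - x - β) / (g y - g x) < ε := by
  obtain ⟨R, hR⟩ := htail (2 / ε)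
  refine ⟨2 * R, fun x y hx hxy hy => ?_⟩
  have h1 := hR ((x + y) / 2) y (by linarith) (by linarith)
  have h2 : g x < g ((x + y) / 2) := hg (by linarith)
  have h3 : g x < g y := hg (by linarith)
  rw [div_lt_iff₀ (sub_pos.2 h3)]
  have h4 : ε * (2 / ε * (y - (x + y) / 2)) = y - x := by
    field_simp
    ring
  have h5 : ε * (2 / ε * (y - (x + y) / 2)) ≤ ε * (g y - g x) :=
    mul_le_mul_of_nonneg_left (by linarith) hε.le
  linarith

lemma ratioArgmax_nonempty_isCompact {g : ℝ → ℝ} (hc : Continuous g) (hg : StrictMono g)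
    (htail : SlopeTendsToTop g) {β : ℝ} (hβ : 0 < β) :
    (ratioArgmax g β).Nonempty ∧ IsCompact (ratioArgmax g β) := by
  set f : ℝ × ℝ → ℝ := fun p => (p.2 - p.1 - β) / (g p.2 - g p.1) with hf
  have hε : 0 < f (0, 2 * β) := by
    have h : g 0 < g (2 * β) := hg (by linarith)
    exact div_pos (by simp only; linarith) (sub_pos.2 h)
  obtain ⟨R, hR⟩ := hg.exists_ratio_lt htail hβ hε
  set D : Set (ℝ × ℝ) := {p | 0 ≤ p.1 ∧ 0 ≤ p.2 ∧ p.1 + β ≤ p.2} with hD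
  set S := max R (2 * β) with hS
  have hDc : IsClosed D :=
    (isClosed_le continuous_const continuous_fst).inter
      ((isClosed_le continuous_const continuous_snd).inter
        (isClosed_le (continuous_fst.add continuous_const) continuous_snd))
  have hK : IsCompact (Icc (0 : ℝ) S ×ˢ Icc (0 : ℝ) S ∩ D) :=
    (isCompact_Icc.prod isCompact_Icc).inter_right hDc
  have hfc : ContinuousOn f (Icc (0 : ℝ) S ×ˢ Icc (0 : ℝ) S ∩ D) := by
    refine ContinuousOn.div (by fun_prop) (by fun_prop) fun p hp => ?_
    have h : g p.1 < g p.2 := hg (by linarith [hp.2.2.2])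
    exact (sub_pos.2 h).ne'
  have h0 : ((0 : ℝ), 2 * β) ∈ Icc (0 : ℝ) S ×ˢ Icc (0 : ℝ) S ∩ D := by
    have : 2 * β ≤ S := le_max_right _ _
    refine ⟨⟨⟨le_rfl, ?_⟩, ⟨?_, this⟩⟩, le_rfl, ?_, ?_⟩ <;> simp only <;> linarith
  obtain ⟨m, hm, hmax⟩ := hK.exists_isMaxOn ⟨_, h0⟩ hfc
  have hbox : ∀ p ∈ D, f (0, 2 * β) ≤ f p → p ∈ Icc (0 : ℝ) S ×ˢ Icc (0 : ℝ) S ∩ D := by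
    intro p hp hle
    have h2 : p.2 ≤ S := by
      by_contra! hlt
      exact absurd (hR p.1 p.2 hp.1 hp.2.2 ((le_max_left _ _).trans hlt.le)) (not_lt.2 hle)
    exact ⟨⟨⟨hp.1, by linarith [hp.2.2]⟩, hp.2.1, h2⟩, hp⟩
  have hglob : ∀ p ∈ D, f p ≤ f m := by
    intro p hp
    rcases le_total (f (0, 2 * β)) (f p) with h | h
    · exact hmax (hbox p hp h)
    · exact h.trans (hmax h0)
  refine ⟨⟨m, hm.2, hglob⟩, ?_⟩
  have hset : ratioArgmax g β = Icc (0 : ℝ) S ×ˢ Icc (0 : ℝ) S ∩ D ∩ f ⁻¹' Ici (f m) := by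
    ext p
    constructor
    · rintro ⟨hp, hpm⟩
      exact ⟨hbox p hp (hpm _ h0.2), hpm m hm.2⟩
    · rintro ⟨hp, hpm⟩
      exact ⟨hp.2, fun p' hp' => (hglob p' hp').trans hpm⟩
  rw [hset]
  exact hK.of_isClosed_subset (hfc.preimage_isClosed_of_isClosed hK.isClosed isClosed_Ici)
    inter_subset_left

lemma width_le_of_mem_ratioArgmax {g : ℝ → ℝ} (hg : StrictMono g) {β₁ β₂ : ℝ} (hβ₁ : 0 < β₁)
    (hβ : β₁ < β₂) {p r : ℝ × ℝ} (hp : p ∈ ratioArgmax g β₁) (hr : r ∈ ratioArgmax g β₂) :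
    p.2 - p.1 ≤ r.2 - r.1 := by
  obtain ⟨⟨hp1, hp2, hp3⟩, hpm⟩ := hp
  obtain ⟨⟨hr1, hr2, hr3⟩, hrm⟩ := hr
  by_contra! hlt
  have h1 := hpm r ⟨hr1, hr2, by linarith⟩
  have h2 := hrm p ⟨hp1, hp2, by linarith⟩
  have hG : 0 < g p.2 - g p.1 := sub_pos.2 (hg (by linarith))
  have hG' : 0 < g r.2 - g r.1 := sub_pos.2 (hg (by linarith))
  rw [div_le_div_iff₀ hG' hG] at h1
  rw [div_le_div_iff₀ hG hG'] at h2
  generalize g p.2 - g p.1 = G at *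
  generalize g r.2 - g r.1 = G' at *
  have hGG : 0 < G * G' := mul_pos hG hG'
  have h3 := mul_le_mul h1 h2 (mul_nonneg (by linarith) hG'.le) (mul_nonneg (by linarith) hG'.le)
  have h4 : 0 < G * G' * ((p.2 - p.1 - (r.2 - r.1)) * (β₂ - β₁)) :=
    mul_pos hGG (mul_pos (by linarith) (by linarith))
  linarith

lemma monotoneOn_width_ratioArgmax {g : ℝ → ℝ} (hc : Continuous g) (hg : StrictMono g)
    (htail : SlopeTendsToTop g) :
    MonotoneOn (fun β : ℝ => sSup ((fun p : ℝ × ℝ => p.2 - p.1) '' ratioArgmax g β)) (Ioi 0) ∧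
      MonotoneOn (fun β : ℝ => sInf ((fun p : ℝ × ℝ => p.2 - p.1) '' ratioArgmax g β))
        (Ioi 0) := by
  have hne : ∀ β : ℝ, 0 < β → ((fun p : ℝ × ℝ => p.2 - p.1) '' ratioArgmax g β).Nonempty :=
    fun β hβ => (ratioArgmax_nonempty_isCompact hc hg htail hβ).1.image _
  have hcp : ∀ β : ℝ, 0 < β → IsCompact ((fun p : ℝ × ℝ => p.2 - p.1) '' ratioArgmax g β) :=
    fun β hβ => (ratioArgmax_nonempty_isCompact hc hg htail hβ).2.image (by fun_prop)
  constructor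
  · intro β₁ h1 β₂ h2 h12
    rcases h12.eq_or_lt with rfl | hlt
    · exact le_rfl
    obtain ⟨_, r, hr, rfl⟩ := hne β₂ h2
    refine csSup_le (hne β₁ h1) ?_
    rintro _ ⟨p, hp, rfl⟩
    exact (width_le_of_mem_ratioArgmax hg h1 hlt hp hr).trans
      (le_csSup (hcp β₂ h2).bddAbove ⟨r, hr, rfl⟩)
  · intro β₁ h1 β₂ h2 h12
    rcases h12.eq_or_lt with rfl | hlt
    · exact le_rfl
    obtain ⟨_, p, hp, rfl⟩ := hne β₁ h1
    refine le_csInf (hne β₂ h2) ?_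
    rintro _ ⟨r, hr, rfl⟩
    exact (csInf_le (hcp β₁ h1).bddBelow ⟨p, hp, rfl⟩).trans
      (width_le_of_mem_ratioArgmax hg h1 hlt hp hr)

lemma strictMonoOn_exp_combination {c α γ : ℝ} (hα : 0 < α) (hγ : 0 < γ) (hc : 0 < 1 - c)
    (h : 0 < (1 - c) * α - c * γ) :
    StrictMonoOn (fun s : ℝ => (1 - c) * exp (α * s) + c * exp (-γ * s)) (Ici 0) := by
  refine strictMonoOn_of_deriv_pos (convex_Ici 0) (by fun_prop) fun s hs => ?_
  rw [interior_Ici, mem_Ioi] at hs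
  have hd : HasDerivAt (fun s : ℝ => (1 - c) * exp (α * s) + c * exp (-γ * s))
      ((1 - c) * (exp (α * s) * (α * 1)) + c * (exp (-γ * s) * (-γ * 1))) s :=
    ((((hasDerivAt_id s).const_mul α).exp).const_mul (1 - c)).add
      ((((hasDerivAt_id s).const_mul (-γ)).exp).const_mul c)
  rw [hd.deriv]
  have h1 : 1 ≤ exp (α * s) := one_le_exp (by positivity)
  have h2 : exp (-γ * s) ≤ 1 := exp_le_one_iff.2 (by nlinarith)
  have h3 : (1 - c) * α * 1 ≤ (1 - c) * α * exp (α * s) :=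
    mul_le_mul_of_nonneg_left h1 (by positivity)
  have h4 := exp_pos (-γ * s)
  rcases le_total c 0 with hc0 | hc0
  · have h5 : 0 ≤ -c * γ * exp (-γ * s) := mul_nonneg (mul_nonneg (by linarith) hγ.le) h4.le
    have h6 : 0 < (1 - c) * α := mul_pos hc hα
    linarith
  · have h5 : c * γ * exp (-γ * s) ≤ c * γ * 1 :=
      mul_le_mul_of_nonneg_left h2 (by positivity)
    linarith

lemma slopeTendsToTop_of_eq_exp {g : ℝ → ℝ} {a A B α γ : ℝ} (hA : 0 < A) (hα : 0 < α)
    (hγ : 0 < γ)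
    (hg : ∀ x, a < x → g x = A * exp (α * (x - a)) + B * exp (-γ * (x - a))) :
    SlopeTendsToTop g := by
  intro K
  refine ⟨max (a + 1) (a + (|K| + |B| * γ) / (A * α * α)), fun u v hu huv => ?_⟩
  have hua : a + 1 ≤ u := (le_max_left _ _).trans hu
  have hub : (|K| + |B| * γ) / (A * α * α) ≤ u - a := by
    linarith [(le_max_right (a + 1) (a + (|K| + |B| * γ) / (A * α * α))).trans hu]
  rw [div_le_iff₀ (by positivity)] at hub
  rw [hg u (by linarith), hg v (by linarith)]
  have hw : 0 ≤ v - u := by linarith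
  have e1 : exp (α * (u - a)) * (α * (v - u)) ≤ exp (α * (v - a)) - exp (α * (u - a)) := by
    have h : exp (α * (v - a)) = exp (α * (u - a)) * exp (α * (v - u)) := by
      rw [← exp_add]; congr 1; ring
    have h' := mul_le_mul_of_nonneg_left (add_one_le_exp (α * (v - u))) (exp_pos (α * (u - a))).le
    rw [h]
    linarith
  have e2 : α * (u - a) ≤ exp (α * (u - a)) := by linarith [add_one_le_exp (α * (u - a))]
  have e3 : α * (u - a) * (α * (v - u)) ≤ exp (α * (v - a)) - exp (α * (u - a)) :=
    (mul_le_mul_of_nonneg_right e2 (by positivity)).trans e1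
  have e4 : exp (-γ * (u - a)) - exp (-γ * (v - a)) ≤ γ * (v - u) := by
    have h : exp (-γ * (v - a)) = exp (-γ * (u - a)) * exp (-γ * (v - u)) := by
      rw [← exp_add]; congr 1; ring
    have h1 : exp (-γ * (u - a)) ≤ 1 := exp_le_one_iff.2 (by nlinarith)
    have h2 := add_one_le_exp (-γ * (v - u))
    have h3 : exp (-γ * (v - u)) ≤ 1 := exp_le_one_iff.2 (by nlinarith)
    have h4 : exp (-γ * (u - a)) * (1 - exp (-γ * (v - u))) ≤ 1 * (1 - exp (-γ * (v - u))) :=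
      mul_le_mul_of_nonneg_right h1 (by linarith)
    rw [h]
    linarith
  have e5 : 0 ≤ exp (-γ * (u - a)) - exp (-γ * (v - a)) :=
    sub_nonneg.2 (exp_le_exp.2 (by nlinarith))
  have e6 : B * (exp (-γ * (u - a)) - exp (-γ * (v - a))) ≤ |B| * (γ * (v - u)) :=
    (mul_le_mul_of_nonneg_right (le_abs_self B) e5).trans
      (mul_le_mul_of_nonneg_left e4 (abs_nonneg B))
  have e7 := mul_le_mul_of_nonneg_left e3 hA.le
  have e8 := mul_le_mul_of_nonneg_right hub hw
  have e9 := mul_le_mul_of_nonneg_right (le_abs_self K) hw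
  linarith

lemma sqrt_add_and_sub_div_pos {q σ : ℝ} (hq : 0 < q) (hσ : 0 < σ) (μ : ℝ) :
    0 < (√(μ ^ 2 + 2 * q * σ ^ 2) + μ) / σ ^ 2 ∧ 0 < (√(μ ^ 2 + 2 * q * σ ^ 2) - μ) / σ ^ 2 := by
  have h : |μ| < √(μ ^ 2 + 2 * q * σ ^ 2) := by
    apply Real.lt_sqrt_of_sq_lt
    rw [sq_abs]
    have : 0 < 2 * q * σ ^ 2 := by positivity
    linarith
  obtain ⟨h1, h2⟩ := abs_lt.1 h
  exact ⟨div_pos (by linarith) (by positivity), div_pos (by linarith) (by positivity)⟩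

/-- A function glued at `a` from `exp (η * (x - a))` on the left and
`(1 - c) * exp (α * (x - a)) + c * exp (-γ * (x - a))` on the right, where
`c = (α - η) / (α + γ)` matches the derivatives. -/
lemma continuous_strictMono_glued_exp {a c α γ η : ℝ} (hα : 0 < α) (hγ : 0 < γ) (hη : 0 < η)
    (hc : c = (α - η) / (α + γ)) {f : ℝ → ℝ}
    (hr : ∀ x, a ≤ x → f x = (1 - c) * exp (α * (x - a)) + c * exp (-γ * (x - a)))
    (hl : ∀ x, x ≤ a → f x = exp (η * (x - a))) :
    0 < 1 - c ∧ Continuous f ∧ StrictMono f := by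
  have hαγ : 0 < α + γ := by positivity
  have hc1 : 1 - c = (γ + η) / (α + γ) := by
    rw [hc]; field_simp; ring
  have hcpos : 0 < 1 - c := by rw [hc1]; positivity
  have hslope : 0 < (1 - c) * α - c * γ := by
    have : (1 - c) * α - c * γ = η := by
      rw [hc]; field_simp; ring
    rwa [this]
  have hmono := strictMonoOn_exp_combination hα hγ hcpos hslope
  refine ⟨hcpos, ?_, ?_⟩
  · have hL : ContinuousOn f (Iic a) :=
      ContinuousOn.congr (f := fun x => exp (η * (x - a))) (by fun_prop) fun x hx => hl x hx
    have hR : ContinuousOn f (Ici a) :=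
      ContinuousOn.congr
        (f := fun x => (1 - c) * exp (α * (x - a)) + c * exp (-γ * (x - a)))
        (by fun_prop) fun x hx => hr x hx
    have := hL.union_of_isClosed hR isClosed_Iic isClosed_Ici
    rwa [Iic_union_Ici, continuousOn_univ] at this
  · refine StrictMonoOn.Iic_union_Ici (a := a) (fun x hx y hy hxy => ?_) fun x hx y hy hxy => ?_
    · rw [hl x hx, hl y hy]
      exact exp_lt_exp.2 (mul_lt_mul_of_pos_left (by linarith) hη)
    · rw [hr x hx, hr y hy]
      exact hmono (mem_Ici.2 (sub_nonneg.2 hx)) (mem_Ici.2 (sub_nonneg.2 hy)) (by linarith)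

theorem statement16
    (a q μp μm σp σm : ℝ)
    (ha : 0 < a) (hq : 0 < q) (hσp : 0 < σp) (hσm : 0 < σm)
    (θ1p θ2p θ1m θ2m cm cp : ℝ)
    (hθ1p : θ1p = (Real.sqrt (μp ^ 2 + 2 * q * σp ^ 2) + μp) / σp ^ 2)
    (hθ2p : θ2p = (Real.sqrt (μp ^ 2 + 2 * q * σp ^ 2) - μp) / σp ^ 2)
    (hθ1m : θ1m = (Real.sqrt (μm ^ 2 + 2 * q * σm ^ 2) + μm) / σm ^ 2)
    (hθ2m : θ2m = (Real.sqrt (μm ^ 2 + 2 * q * σm ^ 2) - μm) / σm ^ 2)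
    (hcm : cm = (θ1m - θ1p) / (θ2m + θ1m))
    (hcp : cp = (θ2p - θ2m) / (θ2p + θ1p))
    (gm gp g : ℝ → ℝ)
    (hgm : ∀ x, gm x = if a < x then Real.exp (-θ1p * (x - a))
      else cm * Real.exp (θ2m * (x - a)) + (1 - cm) * Real.exp (-θ1m * (x - a)))
    (hgp : ∀ x, gp x = if a < x then (1 - cp) * Real.exp (θ2p * (x - a)) + cp * Real.exp (-θ1p * (x - a))
      else Real.exp (θ2m * (x - a)))
    (hg : ∀ x, g x = gp x * gm 0 - gm x * gp 0)
    (Dζ : ℝ → Set (ℝ × ℝ))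
    (hD : ∀ β : ℝ, Dζ β = {p : ℝ × ℝ | 0 ≤ p.1 ∧ 0 ≤ p.2 ∧ p.1 + β ≤ p.2})
    (ζ : ℝ → ℝ → ℝ → ℝ)
    (hζ : ∀ β z₁ z₂ : ℝ, ζ β z₁ z₂ = (z₂ - z₁ - β) / (g z₂ - g z₁))
    (Mζ : ℝ → Set (ℝ × ℝ))
    (hM : ∀ β : ℝ, Mζ β = {p ∈ Dζ β | ∀ p' ∈ Dζ β, ζ β p'.1 p'.2 ≤ ζ β p.1 p.2})
    :
    (∀ β : ℝ, 0 < β → (Mζ β).Nonempty ∧ IsCompact (Mζ β)) ∧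
      MonotoneOn (fun β : ℝ => sSup ((fun p : ℝ × ℝ => p.2 - p.1) '' Mζ β)) (Set.Ioi 0) ∧
      MonotoneOn (fun β : ℝ => sInf ((fun p : ℝ × ℝ => p.2 - p.1) '' Mζ β)) (Set.Ioi 0) := by
  obtain ⟨p1, p2⟩ := sqrt_add_and_sub_div_pos hq hσp μp
  obtain ⟨m1, m2⟩ := sqrt_add_and_sub_div_pos hq hσm μm
  rw [← hθ1p] at p1
  rw [← hθ2p] at p2
  rw [← hθ1m] at m1
  rw [← hθ2m] at m2
  obtain ⟨hcp1, hgpc, hgpm⟩ := continuous_strictMono_glued_exp (a := a) (f := gp) p2 p1 m2 hcp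
    (fun x hx => by
      rcases hx.eq_or_lt with rfl | hlt
      · simp [hgp]
      · rw [hgp, if_pos hlt])
    (fun x hx => by rw [hgp, if_neg (not_lt.2 hx)])
  obtain ⟨hcm1, hgmc, hgmm⟩ := continuous_strictMono_glued_exp (a := -a) (c := cm)
    (f := fun x => gm (-x)) m1 m2 p1 (by rw [hcm, add_comm])
    (fun x hx => by
      rw [hgm, if_neg (by linarith), add_comm]
      congr 3 <;> ring_nf)
    (fun x hx => by
      rcases hx.eq_or_lt with rfl | hlt
      · simp [hgm]
      · rw [hgm, if_pos (by linarith)]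
        ring_nf)
  have hgm_cont : Continuous gm := by
    simpa [Function.comp_def] using hgmc.comp continuous_neg
  have hgm_anti : StrictAnti gm := fun x y hxy => by
    simpa using hgmm (neg_lt_neg hxy)
  have hgp0 : 0 < gp 0 := by
    rw [hgp, if_neg (by linarith)]
    exact exp_pos _
  have hgm0 : 0 < gm 0 := by
    have h : gm a < gm 0 := hgm_anti ha
    have h1 : gm a = 1 := by simp [hgm]
    linarith
  have hg_cont : Continuous g := by
    rw [funext hg]
    fun_prop
  have hg_mono : StrictMono g := fun x y hxy => by
    rw [hg, hg]
    have h1 := mul_lt_mul_of_pos_right (hgpm hxy) hgm0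
    have h2 := mul_lt_mul_of_pos_right (hgm_anti hxy) hgp0
    linarith
  have htail : SlopeTendsToTop g :=
    slopeTendsToTop_of_eq_exp (a := a) (A := (1 - cp) * gm 0) (B := cp * gm 0 - gp 0)
      (mul_pos hcp1 hgm0) p2 p1 fun x hx => by
        rw [hg, hgp x, hgm x, if_pos hx, if_pos hx]
        ring
  have hMg : Mζ = ratioArgmax g := by
    funext β
    simp only [hM, hD, hζ, ratioArgmax]
  rw [hMg]
  exact ⟨fun β hβ => ratioArgmax_nonempty_isCompact hg_cont hg_mono htail hβ,
    monotoneOn_width_ratioArgmax hg_cont hg_mono htail⟩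
end

section
/- Let (z₁,z₂) ∈ M_ζ and let V be the associated two-barrier value function, i.e. V(x) = g(x)/g'(z₂) for 0 ≤ x < z₂ and V(x) = g(z₂)/g'(z₂) + x − z₂ for x ≥ z₂. Then V(x) − V(y) ≥ x − y − β for all real x ≥ y ≥ 0. -/
open Real Set Filter

/-- Two differentiable functions that agree to first order at `a` glue to a function that is
differentiable at `a`. -/
lemma HasDerivAt.ite_lt {F G : ℝ → ℝ} {a d : ℝ} (hF : HasDerivAt F d a) (hG : HasDerivAt G d a)
    (h : F a = G a) : HasDerivAt (fun x => if a < x then F x else G x) d a := by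
  have h1 : HasDerivWithinAt (fun x => if a < x then F x else G x) d (Iic a) a :=
    hG.hasDerivWithinAt.congr (fun x hx => if_neg (not_lt.2 hx)) (if_neg (lt_irrefl a))
  have h2 : HasDerivWithinAt (fun x => if a < x then F x else G x) d (Ici a) a := by
    refine hF.hasDerivWithinAt.congr (fun x hx => ?_) (by simp [h])
    rcases eq_or_lt_of_le (mem_Ici.1 hx) with rfl | hlt
    · simp [h]
    · simp [hlt]
  simpa [Iic_union_Ici, hasDerivWithinAt_univ] using h1.union h2

/-- The `C¹` extension of `x ↦ exp (k * (x - a))` beyond `a` by a combination of a growing and a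
decaying exponential has positive derivative everywhere. -/
lemma exists_pos_hasDerivAt_glued_exp {a A B s r k : ℝ} (hA : 0 < A) (hs : 0 < s) (hr : 0 < r)
    (hk : 0 < k) (hAB : A + B = 1) (hd : A * s - B * r = k) (x : ℝ) :
    ∃ d, 0 < d ∧ HasDerivAt (fun x => if a < x then
      A * exp (s * (x - a)) + B * exp (-r * (x - a)) else exp (k * (x - a))) d x := by
  have hexp (c y : ℝ) : HasDerivAt (fun x => exp (c * (x - a))) (exp (c * (y - a)) * c) y := by
    simpa using (((hasDerivAt_id y).sub_const a).const_mul c).exp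
  have hF (y : ℝ) := ((hexp s y).const_mul A).add ((hexp (-r) y).const_mul B)
  rcases lt_trichotomy x a with hx | rfl | hx
  · refine ⟨exp (k * (x - a)) * k, by positivity, (hexp k x).congr_of_eventuallyEq ?_⟩
    filter_upwards [Iio_mem_nhds hx] with y hy
    exact if_neg (not_lt.2 (mem_Iio.1 hy).le)
  · refine ⟨k, hk, HasDerivAt.ite_lt ?_ ?_ ?_⟩
    · exact (hF x).congr_deriv (by simp only [sub_self, mul_zero, exp_zero]; linarith)
    · exact (hexp k x).congr_deriv (by simp)
    · simp [hAB]
  · refine ⟨_, ?_, (hF x).congr_of_eventuallyEq ?_⟩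
    · have h1 : exp (-r * (x - a)) ≤ exp (s * (x - a)) :=
        exp_le_exp.2 (by nlinarith [sub_pos.2 hx])
      have h2 : 0 < k * exp (-r * (x - a)) := by positivity
      have h3 := mul_le_mul_of_nonneg_left h1 (mul_pos hA hs).le
      rw [← hd] at h2
      linarith
    · filter_upwards [Ioi_mem_nhds hx] with y hy
      exact if_pos (mem_Ioi.1 hy)

/-- Let `(z₁, z₂)` maximise `(y - x - β) / (g y - g x)` over `0 ≤ x`, `x + β ≤ y`, where `g` is
differentiable and increasing. Then the optimal ratio is positive and is `1 / g' z₂`. -/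
lemma ratio_pos_and_mul_deriv_eq_one {g : ℝ → ℝ} {β z₁ z₂ : ℝ} (hg : StrictMono g)
    (hdiff : Differentiable ℝ g) (hβ : 0 < β) (h₁ : 0 ≤ z₁) (h₁₂ : z₁ + β ≤ z₂)
    (hmax : ∀ x y, 0 ≤ x → x + β ≤ y →
      (y - x - β) / (g y - g x) ≤ (z₂ - z₁ - β) / (g z₂ - g z₁)) :
    0 < (z₂ - z₁ - β) / (g z₂ - g z₁) ∧
      (z₂ - z₁ - β) / (g z₂ - g z₁) * deriv g z₂ = 1 := by
  set R := (z₂ - z₁ - β) / (g z₂ - g z₁) with hR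
  have hgz : 0 < g z₂ - g z₁ := sub_pos.2 (hg (by linarith))
  have hR0 : 0 < R := by
    refine lt_of_lt_of_le ?_ (hmax 0 (2 * β) le_rfl (by linarith))
    exact div_pos (by linarith) (sub_pos.2 (hg (by linarith)))
  have hlt : z₁ + β < z₂ := by
    have : 0 < z₂ - z₁ - β := by
      have := mul_pos hR0 hgz
      rwa [hR, div_mul_cancel₀ _ hgz.ne'] at this
    linarith
  have hloc : IsLocalMax (fun z => z - R * g z) z₂ := by
    filter_upwards [Ioi_mem_nhds hlt] with z hz
    have hz' : z₁ + β < z := hz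
    have h := hmax z₁ z h₁ hz'.le
    rw [div_le_iff₀ (sub_pos.2 (hg (by linarith)))] at h
    have h' : R * (g z₂ - g z₁) = z₂ - z₁ - β := div_mul_cancel₀ _ hgz.ne'
    linarith
  have hder := (hasDerivAt_id z₂).sub ((hdiff z₂).hasDerivAt.const_mul R)
  have := hloc.hasDerivAt_eq_zero hder
  exact ⟨hR0, by linarith⟩

theorem statement18
    (a q μp μm σp σm : ℝ)
    (ha : 0 < a) (hq : 0 < q) (hσp : 0 < σp) (hσm : 0 < σm)
    (θ1p θ2p θ1m θ2m cm cp : ℝ)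
    (hθ1p : θ1p = (Real.sqrt (μp ^ 2 + 2 * q * σp ^ 2) + μp) / σp ^ 2)
    (hθ2p : θ2p = (Real.sqrt (μp ^ 2 + 2 * q * σp ^ 2) - μp) / σp ^ 2)
    (hθ1m : θ1m = (Real.sqrt (μm ^ 2 + 2 * q * σm ^ 2) + μm) / σm ^ 2)
    (hθ2m : θ2m = (Real.sqrt (μm ^ 2 + 2 * q * σm ^ 2) - μm) / σm ^ 2)
    (hcm : cm = (θ1m - θ1p) / (θ2m + θ1m))
    (hcp : cp = (θ2p - θ2m) / (θ2p + θ1p))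
    (gm gp g : ℝ → ℝ)
    (hgm : ∀ x, gm x = if a < x then Real.exp (-θ1p * (x - a))
      else cm * Real.exp (θ2m * (x - a)) + (1 - cm) * Real.exp (-θ1m * (x - a)))
    (hgp : ∀ x, gp x = if a < x then (1 - cp) * Real.exp (θ2p * (x - a)) + cp * Real.exp (-θ1p * (x - a))
      else Real.exp (θ2m * (x - a)))
    (hg : ∀ x, g x = gp x * gm 0 - gm x * gp 0)
    (β : ℝ) (hβ : 0 < β)
    (Dζ : Set (ℝ × ℝ))
    (hD : Dζ = {p : ℝ × ℝ | 0 ≤ p.1 ∧ 0 ≤ p.2 ∧ p.1 + β ≤ p.2})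
    (ζ : ℝ → ℝ → ℝ)
    (hζ : ∀ z₁ z₂, ζ z₁ z₂ = (z₂ - z₁ - β) / (g z₂ - g z₁))
    (Mζ : Set (ℝ × ℝ))
    (hM : Mζ = {p ∈ Dζ | ∀ p' ∈ Dζ, ζ p'.1 p'.2 ≤ ζ p.1 p.2})
    (z₁ z₂ : ℝ) (hz : (z₁, z₂) ∈ Mζ)
    (V : ℝ → ℝ)
    (hV : ∀ x : ℝ, V x = if x < z₂ then g x / deriv g z₂ else g z₂ / deriv g z₂ + x - z₂)
    :
    ∀ x y : ℝ, 0 ≤ y → y ≤ x → x - y - β ≤ V x - V y := by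
  have key (μ σ : ℝ) (hσ : 0 < σ) : 0 < (√(μ ^ 2 + 2 * q * σ ^ 2) + μ) / σ ^ 2 ∧
      0 < (√(μ ^ 2 + 2 * q * σ ^ 2) - μ) / σ ^ 2 := by
    have h : |μ| < √(μ ^ 2 + 2 * q * σ ^ 2) := by
      rw [← sqrt_sq_eq_abs]
      exact sqrt_lt_sqrt (sq_nonneg μ) (lt_add_of_pos_right _ (by positivity))
    obtain ⟨h1, h2⟩ := abs_lt.1 h
    exact ⟨div_pos (by linarith) (by positivity), div_pos (by linarith) (by positivity)⟩
  have h1p : 0 < θ1p := hθ1p ▸ (key μp σp hσp).1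
  have h2p : 0 < θ2p := hθ2p ▸ (key μp σp hσp).2
  have h1m : 0 < θ1m := hθ1m ▸ (key μm σm hσm).1
  have h2m : 0 < θ2m := hθ2m ▸ (key μm σm hσm).2
  have hcp' : 1 - cp = (θ1p + θ2m) / (θ2p + θ1p) := by rw [hcp]; field_simp; ring
  have hcm' : 1 - cm = (θ2m + θ1p) / (θ2m + θ1m) := by rw [hcm]; field_simp; ring
  have hgp_deriv (x : ℝ) : ∃ d, 0 < d ∧ HasDerivAt gp d x := by
    have := exists_pos_hasDerivAt_glued_exp (a := a) (A := 1 - cp) (B := cp) (k := θ2m)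
      (by rw [hcp']; positivity) h2p h1p h2m (by ring)
      (by rw [hcp', hcp]; field_simp; ring) x
    rwa [← funext hgp] at this
  have hgm_deriv (x : ℝ) : ∃ d, 0 < d ∧ HasDerivAt gm (-d) x := by
    obtain ⟨d, hd, h⟩ := exists_pos_hasDerivAt_glued_exp (a := -a) (A := 1 - cm) (B := cm)
      (k := θ1p) (by rw [hcm']; positivity) h1m h2m h1p (by ring)
      (by rw [hcm', hcm]; field_simp; ring) (-x)
    refine ⟨d, hd, ?_⟩
    have h' := h.comp x (hasDerivAt_neg x)
    rw [mul_neg_one] at h'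
    refine h'.congr_of_eventuallyEq (Eventually.of_forall fun y => ?_)
    simp only [hgm, Function.comp_apply, neg_lt_neg_iff]
    rcases lt_trichotomy y a with hy | rfl | hy
    · rw [if_neg (not_lt.2 hy.le), if_pos hy]
      ring_nf
    · simp
    · rw [if_pos hy, if_neg (not_lt.2 hy.le)]
      ring_nf
  have hgp0 : 0 < gp 0 := by
    rw [hgp, if_neg (not_lt.2 ha.le)]
    positivity
  have hgm_anti : StrictAnti gm := by
    refine strictAnti_of_deriv_neg fun x => ?_
    obtain ⟨d, hd, h⟩ := hgm_deriv x
    rw [h.deriv]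
    linarith
  have hgm0 : 0 < gm 0 := by
    have h := hgm_anti ha
    have : gm a = 1 := by simp [hgm]
    linarith
  have hg_deriv (x : ℝ) : ∃ d, 0 < d ∧ HasDerivAt g d x := by
    obtain ⟨d, hd, h⟩ := hgp_deriv x
    obtain ⟨e, he, h'⟩ := hgm_deriv x
    refine ⟨d * gm 0 - -e * gp 0, ?_, ?_⟩
    · have := mul_pos hd hgm0
      have := mul_pos he hgp0
      linarith
    · rw [funext hg]
      exact (h.mul_const _).sub (h'.mul_const _)
  have hg_mono : StrictMono g := by
    refine strictMono_of_deriv_pos fun x => ?_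
    obtain ⟨d, hd, h⟩ := hg_deriv x
    rwa [h.deriv]
  have hg_diff : Differentiable ℝ g := fun x => (hg_deriv x).choose_spec.2.differentiableAt
  rw [hM, hD] at hz
  obtain ⟨⟨hz₁, -, hz₁₂⟩, hmax⟩ := hz
  simp only [hζ] at hz₁ hz₁₂ hmax
  replace hmax (x y : ℝ) (hx : 0 ≤ x) (hxy : x + β ≤ y) :=
    hmax (x, y) ⟨hx, by simpa using by linarith, hxy⟩
  obtain ⟨hR0, hRd⟩ := ratio_pos_and_mul_deriv_eq_one hg_mono hg_diff hβ hz₁ hz₁₂ hmax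
  set R := (z₂ - z₁ - β) / (g z₂ - g z₁)
  have hdiv (t : ℝ) : t / deriv g z₂ = R * t := by
    rw [div_eq_iff (right_ne_zero_of_mul_eq_one hRd)]
    linear_combination -t * hRd
  have hbound (x y : ℝ) (hy : 0 ≤ y) (hyx : y ≤ x) : x - y - β ≤ R * g x - R * g y := by
    rw [← mul_sub]
    rcases le_or_gt (y + β) x with h | h
    · exact (div_le_iff₀ (sub_pos.2 (hg_mono (by linarith)))).1 (hmax y x hy h)
    · have := mul_nonneg hR0.le (sub_nonneg.2 (hg_mono.monotone hyx))
      linarith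
  intro x y hy hyx
  simp only [hV, hdiv]
  split_ifs with hx hy' hy'
  · exact hbound x y hy hyx
  · linarith
  · have := hbound z₂ y hy hy'.le
    linarith
  · linarith
end

section
/- Let (z₁,z₂) ∈ M_ζ and let V be the associated two-barrier value function, i.e. V(x) = g(x)/g'(z₂) for 0 ≤ x < z₂ and V(x) = g(z₂)/g'(z₂) + x − z₂ for x ≥ z₂. Suppose one of the following holds: (a) z₂ > a; (b) z₂ ≤ a and μ₊ − q·(a − z₂ + g(z₂)/g'(z₂)) ≤ 0; (c) the right-hand limit g''(a+) ≥ 0. Then for every x ∈ (0,∞) with x ≠ a and x ≠ z₂ one has ½·σ(x)²·V''(x) + μ(x)·V'(x) − q·V(x) ≤ 0, where σ(x) := σ₊ and μ(x) := μ₊ if x > a, and σ(x) := σ₋ and μ(x) := μ₋ if x ≤ a. -/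
/-- A combination of two exponentials, based at `a`. -/
noncomputable def expSum (A B r s a x : ℝ) : ℝ :=
  A * Real.exp (r * (x - a)) + B * Real.exp (s * (x - a))

lemma hasDerivAt_expSum (A B r s a x : ℝ) :
    HasDerivAt (expSum A B r s a) (expSum (A * r) (B * s) r s a x) x := by
  have h (t : ℝ) : HasDerivAt (fun y => Real.exp (t * (y - a)))
      (Real.exp (t * (x - a)) * (t * 1)) x :=
    (((hasDerivAt_id x).sub_const a).const_mul t).exp
  refine (((h r).const_mul A).add ((h s).const_mul B)).congr_deriv ?_
  simp only [expSum]
  ring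

lemma deriv_expSum (A B r s a : ℝ) :
    deriv (expSum A B r s a) = expSum (A * r) (B * s) r s a :=
  funext fun x => (hasDerivAt_expSum A B r s a x).deriv

lemma continuous_expSum (A B r s a : ℝ) : Continuous (expSum A B r s a) :=
  continuous_iff_continuousAt.2 fun x => (hasDerivAt_expSum A B r s a x).continuousAt

lemma expSum_ode {σ μ q r s : ℝ} (hr : 1 / 2 * σ ^ 2 * r ^ 2 + μ * r - q = 0)
    (hs : 1 / 2 * σ ^ 2 * s ^ 2 + μ * s - q = 0) (A B a x : ℝ) :
    1 / 2 * σ ^ 2 * expSum (A * r * r) (B * s * s) r s a x +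
      μ * expSum (A * r) (B * s) r s a x - q * expSum A B r s a x = 0 := by
  simp only [expSum]
  linear_combination A * Real.exp (r * (x - a)) * hr + B * Real.exp (s * (x - a)) * hs

lemma expSum_monotone {A B r s : ℝ} (hA : 0 ≤ A) (hB : B ≤ 0) (hr : 0 ≤ r) (hs : s ≤ 0)
    (a : ℝ) : Monotone (expSum A B r s a) := by
  intro x y hxy
  have h1 : Real.exp (r * (x - a)) ≤ Real.exp (r * (y - a)) :=
    Real.exp_le_exp.2 (mul_le_mul_of_nonneg_left (by linarith) hr)
  have h2 : Real.exp (s * (y - a)) ≤ Real.exp (s * (x - a)) :=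
    Real.exp_le_exp.2 (mul_le_mul_of_nonpos_left (by linarith) hs)
  exact add_le_add (mul_le_mul_of_nonneg_left h1 hA) (mul_le_mul_of_nonpos_left h2 hB)

lemma expSum_pos_of_le {A B r s a x : ℝ} (hA : 0 ≤ A) (hsr : s ≤ r)
    (h : 0 < A + B) (hx : a ≤ x) : 0 < expSum A B r s a x := by
  have h1 : Real.exp (s * (x - a)) ≤ Real.exp (r * (x - a)) :=
    Real.exp_le_exp.2 (mul_le_mul_of_nonneg_right hsr (by linarith))
  calc 0 < (A + B) * Real.exp (s * (x - a)) := by positivity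
    _ = A * Real.exp (s * (x - a)) + B * Real.exp (s * (x - a)) := by ring
    _ ≤ expSum A B r s a x := by
      unfold expSum
      gcongr

lemma characteristic_root {σ μ q θ : ℝ} (hσ : 0 < σ) (hq : 0 < q)
    (hθ : θ = (Real.sqrt (μ ^ 2 + 2 * q * σ ^ 2) + μ) / σ ^ 2) :
    0 < θ ∧ 1 / 2 * σ ^ 2 * θ ^ 2 - μ * θ - q = 0 := by
  have hpos : 0 < 2 * q * σ ^ 2 := by positivity
  have hsq := Real.sq_sqrt (show 0 ≤ μ ^ 2 + 2 * q * σ ^ 2 by positivity)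
  have habs : |μ| < Real.sqrt (μ ^ 2 + 2 * q * σ ^ 2) :=
    Real.lt_sqrt_of_sq_lt (by rw [sq_abs]; linarith)
  have hθσ : θ * σ ^ 2 = Real.sqrt (μ ^ 2 + 2 * q * σ ^ 2) + μ := by
    rw [hθ]
    field_simp
  constructor
  · rw [hθ]
    have := neg_abs_le μ
    exact div_pos (by linarith) (by positivity)
  · have hs : Real.sqrt (μ ^ 2 + 2 * q * σ ^ 2) = θ * σ ^ 2 - μ := by linarith
    rw [hs] at hsq
    have h0 : σ ^ 2 * (1 / 2 * σ ^ 2 * θ ^ 2 - μ * θ - q) = 0 := by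
      linear_combination hsq / 2
    exact (mul_eq_zero.1 h0).resolve_left (by positivity)

lemma IsLocalMax.deriv_deriv_nonpos {f : ℝ → ℝ} {x : ℝ} (h : IsLocalMax f x)
    (hf : ContinuousAt f x) : deriv (deriv f) x ≤ 0 := by
  by_contra! hpos
  have hmin := isLocalMin_of_deriv_deriv_pos hpos h.deriv_eq_zero hf
  have heq : f =ᶠ[nhds x] fun _ => f x := by
    filter_upwards [h, hmin] with y h1 h2 using le_antisymm h1 h2
  have hd := heq.deriv.deriv_eq
  simp at hd
  exact hpos.ne' hd

lemma deriv_deriv_nonneg_of_ratio_maximal {g : ℝ → ℝ} (hg : Differentiable ℝ g)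
    (hmono : StrictMono g) {β z₁ z₂ : ℝ} (hβ : 0 < β) (hz₁ : 0 ≤ z₁) (hz : z₁ + β ≤ z₂)
    (hmax : ∀ x y : ℝ, 0 ≤ x → x + β ≤ y →
      (y - x - β) / (g y - g x) ≤ (z₂ - z₁ - β) / (g z₂ - g z₁)) :
    0 ≤ deriv (deriv g) z₂ := by
  obtain ⟨k, hk⟩ : ∃ k, k = (z₂ - z₁ - β) / (g z₂ - g z₁) := ⟨_, rfl⟩
  rw [← hk] at hmax
  have hg12 : 0 < g z₂ - g z₁ := sub_pos.2 (hmono (by linarith))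
  have hkpos : 0 < k := by
    refine lt_of_lt_of_le ?_ (hmax 0 (2 * β) le_rfl (by linarith))
    exact div_pos (by linarith) (sub_pos.2 (hmono (by linarith)))
  have hkz : k * (g z₂ - g z₁) = z₂ - z₁ - β := by
    rw [hk, div_mul_cancel₀ _ hg12.ne']
  have hlt : z₁ + β < z₂ := by
    have := mul_pos hkpos hg12
    linarith
  have hloc : IsLocalMax (fun y => y - k * g y) z₂ := by
    filter_upwards [lt_mem_nhds hlt] with y hy
    have := hmax z₁ y hz₁ hy.le
    rw [div_le_iff₀ (sub_pos.2 (hmono (by linarith)))] at this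
    linarith
  have hd : deriv (fun y => y - k * g y) = fun y => 1 - k * deriv g y :=
    funext fun y => ((hasDerivAt_id y).sub ((hg y).hasDerivAt.const_mul k)).deriv
  have hdd := hloc.deriv_deriv_nonpos
    (continuousAt_id.sub ((hg z₂).continuousAt.const_mul k))
  rw [hd, deriv_const_sub, deriv_const_mul_field] at hdd
  by_contra! hneg
  have := mul_neg_of_pos_of_neg hkpos hneg
  linarith

lemma div_le_of_deriv_monotone {f f' : ℝ → ℝ} {x y : ℝ} (hf : ∀ t, HasDerivAt f (f' t) t)
    (hmono : MonotoneOn f' (Set.Icc x y)) (hxy : x ≤ y) (hx : 0 ≤ f x) (hx' : 0 < f' x) :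
    f y / f' y ≤ y - x + f x / f' x := by
  have hle : f' x ≤ f' y := hmono ⟨le_rfl, hxy⟩ ⟨hxy, le_rfl⟩ hxy
  have hy' : 0 < f' y := hx'.trans_le hle
  have hslope : f y - f x ≤ f' y * (y - x) :=
    Convex.image_sub_le_mul_sub_of_deriv_le (convex_Icc x y)
      (fun t _ => (hf t).continuousAt.continuousWithinAt)
      (fun t _ => (hf t).differentiableAt.differentiableWithinAt)
      (fun t ht => by
        rw [(hf t).deriv]
        exact hmono (interior_subset ht) ⟨hxy, le_rfl⟩ (interior_subset ht).2)
      x ⟨le_rfl, hxy⟩ y ⟨hxy, le_rfl⟩ hxy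
  have hdiv : f x / f' y ≤ f x / f' x := div_le_div_of_nonneg_left hx hx' hle
  have h : f y / f' y ≤ y - x + f x / f' y := by
    rw [div_le_iff₀ hy', add_mul, div_mul_cancel₀ _ hy'.ne']
    linarith
  linarith

/-- The two-barrier value inequality for a function glued at `a` from two combinations of
exponentials, whose exponents solve the characteristic equations on either side. -/
lemma generator_nonpos_of_glued_expSum {a q μp μm σp σm A B C D r s u v : ℝ}
    (hq : 0 < q)
    (hr : 1 / 2 * σm ^ 2 * r ^ 2 + μm * r - q = 0)
    (hs : 1 / 2 * σm ^ 2 * s ^ 2 + μm * s - q = 0)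
    (hu : 1 / 2 * σp ^ 2 * u ^ 2 + μp * u - q = 0)
    (hv : 1 / 2 * σp ^ 2 * v ^ 2 + μp * v - q = 0)
    (hr0 : 0 < r) (hs0 : s < 0) (hu0 : 0 < u) (hv0 : v < 0)
    (hA : 0 < A) (hB : B < 0) (hC : 0 < C)
    (hval : A + B = C + D) (hder : A * r + B * s = C * u + D * v)
    {g : ℝ → ℝ}
    (hgl : ∀ x ≤ a, g x = expSum A B r s a x)
    (hgr : ∀ x, a < x → g x = expSum C D u v a x)
    (hg0 : g 0 = 0)
    {β z₁ z₂ : ℝ} (hβ : 0 < β) (hz₁ : 0 ≤ z₁) (hz : z₁ + β ≤ z₂)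
    (hmax : ∀ x y : ℝ, 0 ≤ x → x + β ≤ y →
      (y - x - β) / (g y - g x) ≤ (z₂ - z₁ - β) / (g z₂ - g z₁))
    {V : ℝ → ℝ}
    (hV : ∀ x : ℝ, V x = if x < z₂ then g x / deriv g z₂ else g z₂ / deriv g z₂ + x - z₂)
    (hcond : a < z₂ ∨
      (z₂ ≤ a ∧ μp - q * (a - z₂ + g z₂ / deriv g z₂) ≤ 0) ∨
      (∃ L : ℝ, Filter.Tendsto (fun x => deriv (deriv g) x) (nhdsWithin a (Set.Ioi a)) (nhds L) ∧
        0 ≤ L))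
    {x : ℝ} (hxa : x ≠ a) (hxz : x ≠ z₂) :
    (1 / 2) * (if a < x then σp else σm) ^ 2 * deriv (deriv V) x +
      (if a < x then μp else μm) * deriv V x - q * V x ≤ 0 := by
  have hnl {y : ℝ} (hy : y < a) : g =ᶠ[nhds y] expSum A B r s a := by
    filter_upwards [gt_mem_nhds hy] with t ht using hgl t ht.le
  have hnr {y : ℝ} (hy : a < y) : g =ᶠ[nhds y] expSum C D u v a := by
    filter_upwards [lt_mem_nhds hy] with t ht using hgr t ht
  have hval_a : expSum A B r s a a = expSum C D u v a a := by simpa [expSum] using hval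
  have hder_a : expSum (A * r) (B * s) r s a a = expSum (C * u) (D * v) u v a a := by
    simpa [expSum] using hder
  have hga : HasDerivAt g (expSum (A * r) (B * s) r s a a) a := by
    have h1 : HasDerivWithinAt g (expSum (A * r) (B * s) r s a a) (Set.Iic a) a :=
      (hasDerivAt_expSum A B r s a a).hasDerivWithinAt.congr (fun t ht => hgl t ht) (hgl a le_rfl)
    have h2 : HasDerivWithinAt g (expSum (A * r) (B * s) r s a a) (Set.Ioi a) a := by
      rw [hder_a]
      exact (hasDerivAt_expSum C D u v a a).hasDerivWithinAt.congr (fun t ht => hgr t ht)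
        ((hgl a le_rfl).trans hval_a)
    have h := h1.union h2
    rwa [Set.Iic_union_Ioi, hasDerivWithinAt_univ] at h
  have hdl {y : ℝ} (hy : y ≤ a) : HasDerivAt g (expSum (A * r) (B * s) r s a y) y := by
    rcases hy.lt_or_eq with h | rfl
    · exact (hasDerivAt_expSum A B r s a y).congr_of_eventuallyEq (hnl h)
    · exact hga
  have hdr {y : ℝ} (hy : a < y) : HasDerivAt g (expSum (C * u) (D * v) u v a y) y :=
    (hasDerivAt_expSum C D u v a y).congr_of_eventuallyEq (hnr hy)
  have hddl {y : ℝ} (hy : y < a) :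
      deriv (deriv g) y = expSum (A * r * r) (B * s * s) r s a y := by
    rw [(hnl hy).deriv.deriv_eq, deriv_expSum, deriv_expSum]
  have hddr {y : ℝ} (hy : a < y) :
      deriv (deriv g) y = expSum (C * u * u) (D * v * v) u v a y := by
    rw [(hnr hy).deriv.deriv_eq, deriv_expSum, deriv_expSum]
  have hdiff : Differentiable ℝ g := fun y =>
    (le_or_gt y a).elim (fun h => (hdl h).differentiableAt) fun h => (hdr h).differentiableAt
  have hBs : 0 < B * s := mul_pos_of_neg_of_neg hB hs0
  have hleft' (y : ℝ) : 0 < expSum (A * r) (B * s) r s a y := by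
    unfold expSum
    positivity
  have hpos (y : ℝ) : 0 < deriv g y := by
    rcases le_or_gt y a with hy | hy
    · rw [(hdl hy).deriv]
      exact hleft' y
    · rw [(hdr hy).deriv]
      refine expSum_pos_of_le (by positivity) (by linarith) ?_ hy.le
      rw [← hder]
      positivity
  have hmono : StrictMono g := strictMono_of_deriv_pos hpos
  have hconv := deriv_deriv_nonneg_of_ratio_maximal hdiff hmono hβ hz₁ hz hmax
  have hgz : 0 ≤ g z₂ := hg0 ▸ hmono.monotone (by linarith)
  have hodel {y : ℝ} (hy : y < a) :
      1 / 2 * σm ^ 2 * deriv (deriv g) y + μm * deriv g y - q * g y = 0 := by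
    rw [hddl hy, (hdl hy.le).deriv, hgl y hy.le]
    exact expSum_ode hr hs A B a y
  have hoder {y : ℝ} (hy : a < y) :
      1 / 2 * σp ^ 2 * deriv (deriv g) y + μp * deriv g y - q * g y = 0 := by
    rw [hddr hy, (hdr hy).deriv, hgr y hy]
    exact expSum_ode hu hv C D a y
  have hdrift {σ μ y g₂ g₁ g₀ : ℝ} (hode : 1 / 2 * σ ^ 2 * g₂ + μ * g₁ - q * g₀ = 0)
      (h₂ : 0 ≤ g₂) (h₁ : 0 < g₁) (hy : g₀ / g₁ ≤ y) : μ - q * y ≤ 0 := by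
    have h3 : 0 ≤ 1 / 2 * σ ^ 2 * g₂ := by positivity
    have h4 : μ ≤ q * (g₀ / g₁) := by
      rw [← mul_div_assoc, le_div_iff₀ h₁]
      linarith
    linarith [mul_le_mul_of_nonneg_left hy hq.le]
  rcases lt_or_gt_of_ne hxz with hx | hx
  · have hVx : V =ᶠ[nhds x] fun y => g y / deriv g z₂ := by
      filter_upwards [gt_mem_nhds hx] with y hy
      rw [hV, if_pos hy]
    have hV' : deriv V =ᶠ[nhds x] fun y => deriv g y / deriv g z₂ := by
      filter_upwards [hVx.eventuallyEq_nhds] with y hy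
      rw [hy.deriv_eq, deriv_div_const]
    rw [hV'.deriv_eq, hV'.eq_of_nhds, hVx.eq_of_nhds, deriv_div_const]
    apply le_of_eq
    rcases lt_or_gt_of_ne hxa with h | h
    · simp only [if_neg h.not_gt]
      linear_combination (hodel h) / deriv g z₂
    · simp only [if_pos h]
      linear_combination (hoder h) / deriv g z₂
  · have hVx : V =ᶠ[nhds x] fun y => g z₂ / deriv g z₂ + y - z₂ := by
      filter_upwards [lt_mem_nhds hx] with y hy
      rw [hV, if_neg hy.not_gt]
    have haff : deriv (fun y => g z₂ / deriv g z₂ + y - z₂) = fun _ => 1 :=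
      funext fun y => (((hasDerivAt_id y).const_add _).sub_const _).deriv
    have hdd : deriv (deriv V) x = 0 := by
      rw [hVx.deriv.deriv_eq, haff, deriv_const]
    have hd : deriv V x = 1 := by rw [hVx.deriv_eq, haff]
    rw [hdd, hd, hVx.eq_of_nhds, mul_zero, zero_add, mul_one]
    rcases lt_or_gt_of_ne hxa with h | h
    · simp only [if_neg h.not_gt]
      exact hdrift (hodel (hx.trans h)) hconv (hpos z₂) (by linarith)
    · simp only [if_pos h]
      rcases lt_or_ge a z₂ with haz | haz
      · exact hdrift (hoder haz) hconv (hpos z₂) (by linarith)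
      rcases hcond with hc | ⟨-, hc⟩ | ⟨L, hL, hL0⟩
      · exact absurd hc haz.not_gt
      · have := mul_le_mul_of_nonneg_left
          (show a - z₂ + g z₂ / deriv g z₂ ≤ g z₂ / deriv g z₂ + x - z₂ by linarith) hq.le
        linarith
      · have hlim : Filter.Tendsto (fun y => deriv (deriv g) y) (nhdsWithin a (Set.Ioi a))
            (nhds (expSum (C * u * u) (D * v * v) u v a a)) := by
          refine ((continuous_expSum _ _ _ _ _).tendsto a |>.mono_left nhdsWithin_le_nhds).congr' ?_
          filter_upwards [self_mem_nhdsWithin] with y hy using (hddr hy).symm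
        have hLa : 0 ≤ expSum (C * u * u) (D * v * v) u v a a :=
          tendsto_nhds_unique hL hlim ▸ hL0
        have hode := expSum_ode hu hv C D a a
        rw [← hder_a, ← hval_a] at hode
        refine hdrift hode hLa (hleft' a) ?_
        have hmono' : MonotoneOn (expSum (A * r) (B * s) r s a) (Set.Icc z₂ a) := by
          refine monotoneOn_of_deriv_nonneg (convex_Icc z₂ a)
            (continuous_expSum _ _ _ _ _).continuousOn
            (fun y _ => (hasDerivAt_expSum _ _ _ _ _ y).differentiableAt.differentiableWithinAt) ?_
          intro y hy
          rw [interior_Icc] at hy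
          rw [deriv_expSum]
          rw [hddl (hy.1.trans hy.2)] at hconv
          refine hconv.trans (expSum_monotone (by positivity) ?_ hr0.le hs0.le a hy.1.le)
          exact (mul_neg_of_pos_of_neg hBs hs0).le
        have hle := div_le_of_deriv_monotone (hasDerivAt_expSum A B r s a) hmono' haz
          (by rwa [← hgl z₂ haz]) (hleft' z₂)
        rw [← hgl z₂ haz, ← (hdl haz).deriv] at hle
        linarith

theorem statement19
    (a q μp μm σp σm : ℝ)
    (ha : 0 < a) (hq : 0 < q) (hσp : 0 < σp) (hσm : 0 < σm)
    (θ1p θ2p θ1m θ2m cm cp : ℝ)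
    (hθ1p : θ1p = (Real.sqrt (μp ^ 2 + 2 * q * σp ^ 2) + μp) / σp ^ 2)
    (hθ2p : θ2p = (Real.sqrt (μp ^ 2 + 2 * q * σp ^ 2) - μp) / σp ^ 2)
    (hθ1m : θ1m = (Real.sqrt (μm ^ 2 + 2 * q * σm ^ 2) + μm) / σm ^ 2)
    (hθ2m : θ2m = (Real.sqrt (μm ^ 2 + 2 * q * σm ^ 2) - μm) / σm ^ 2)
    (hcm : cm = (θ1m - θ1p) / (θ2m + θ1m))
    (hcp : cp = (θ2p - θ2m) / (θ2p + θ1p))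
    (gm gp g : ℝ → ℝ)
    (hgm : ∀ x, gm x = if a < x then Real.exp (-θ1p * (x - a))
      else cm * Real.exp (θ2m * (x - a)) + (1 - cm) * Real.exp (-θ1m * (x - a)))
    (hgp : ∀ x, gp x = if a < x then (1 - cp) * Real.exp (θ2p * (x - a)) + cp * Real.exp (-θ1p * (x - a))
      else Real.exp (θ2m * (x - a)))
    (hg : ∀ x, g x = gp x * gm 0 - gm x * gp 0)
    (β : ℝ) (hβ : 0 < β)
    (Dζ : Set (ℝ × ℝ))
    (hD : Dζ = {p : ℝ × ℝ | 0 ≤ p.1 ∧ 0 ≤ p.2 ∧ p.1 + β ≤ p.2})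
    (ζ : ℝ → ℝ → ℝ)
    (hζ : ∀ z₁ z₂, ζ z₁ z₂ = (z₂ - z₁ - β) / (g z₂ - g z₁))
    (Mζ : Set (ℝ × ℝ))
    (hM : Mζ = {p ∈ Dζ | ∀ p' ∈ Dζ, ζ p'.1 p'.2 ≤ ζ p.1 p.2})
    (z₁ z₂ : ℝ) (hz : (z₁, z₂) ∈ Mζ)
    (V : ℝ → ℝ)
    (hV : ∀ x : ℝ, V x = if x < z₂ then g x / deriv g z₂ else g z₂ / deriv g z₂ + x - z₂)
    (hcond : a < z₂ ∨
      (z₂ ≤ a ∧ μp - q * (a - z₂ + g z₂ / deriv g z₂) ≤ 0) ∨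
      (∃ L : ℝ, Filter.Tendsto (fun x => deriv (deriv g) x) (nhdsWithin a (Set.Ioi a)) (nhds L) ∧
        0 ≤ L))
    :
    ∀ x : ℝ, 0 < x → x ≠ a → x ≠ z₂ →
      (1 / 2) * (if a < x then σp else σm) ^ 2 * deriv (deriv V) x +
        (if a < x then μp else μm) * deriv V x - q * V x ≤ 0 := by
  intro x _ hxa hxz
  obtain ⟨h1p, e1p⟩ := characteristic_root hσp hq hθ1p
  obtain ⟨h1m, e1m⟩ := characteristic_root hσm hq hθ1m
  obtain ⟨h2p, e2p⟩ := characteristic_root (θ := θ2p) (μ := -μp) hσp hq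
    (by rwa [neg_sq, ← sub_eq_add_neg])
  obtain ⟨h2m, e2m⟩ := characteristic_root (θ := θ2m) (μ := -μm) hσm hq
    (by rwa [neg_sq, ← sub_eq_add_neg])
  have hcm' : cm * (θ2m + θ1m) = θ1m - θ1p := by
    rw [hcm, div_mul_cancel₀ _ (by positivity)]
  have hcp' : cp * (θ2p + θ1p) = θ2p - θ2m := by
    rw [hcp, div_mul_cancel₀ _ (by positivity)]
  have hcm1 : 0 < 1 - cm := by
    refine pos_of_mul_pos_left (b := θ2m + θ1m) ?_ (by positivity)
    linarith
  have hcp1 : 0 < 1 - cp := by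
    refine pos_of_mul_pos_left (b := θ2p + θ1p) ?_ (by positivity)
    linarith
  have hgm0 : gm 0 = cm * Real.exp (-θ2m * a) + (1 - cm) * Real.exp (θ1m * a) := by
    rw [hgm, if_neg ha.not_gt]
    congr 3 <;> ring_nf
  have hgp0 : gp 0 = Real.exp (-θ2m * a) := by
    rw [hgp, if_neg ha.not_gt]
    congr 1
    ring
  have hgm0pos : 0 < gm 0 := by
    have h : Real.exp (-θ2m * a) ≤ Real.exp (θ1m * a) :=
      Real.exp_le_exp.2 (mul_le_mul_of_nonneg_right (by linarith) ha.le)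
    have h' := mul_le_mul_of_nonneg_left h hcm1.le
    rw [hgm0]
    linarith [Real.exp_pos (-θ2m * a)]
  subst hD hM
  obtain ⟨⟨hz₁, -, hz₁₂⟩, hmax⟩ := hz
  refine generator_nonpos_of_glued_expSum (A := gm 0 - cm * gp 0) (B := -(1 - cm) * gp 0)
    (C := (1 - cp) * gm 0) (D := cp * gm 0 - gp 0) (r := θ2m) (s := -θ1m) (u := θ2p) (v := -θ1p)
    hq (by linarith) (by linarith) (by linarith) (by linarith)
    h2m (by linarith) h2p (by linarith) ?_ ?_ (mul_pos hcp1 hgm0pos) ?_ ?_ ?_ ?_ ?_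
    hβ hz₁ hz₁₂ ?_ hV hcond hxa hxz
  · rw [hgm0, hgp0, add_sub_cancel_left]
    positivity
  · rw [hgp0]
    exact mul_neg_of_neg_of_pos (by linarith) (Real.exp_pos _)
  · ring
  · linear_combination gm 0 * hcp' - gp 0 * hcm'
  · intro y hy
    rw [hg, hgm y, hgp y, if_neg hy.not_gt, if_neg hy.not_gt, expSum]
    ring
  · intro y hy
    rw [hg, hgm y, hgp y, if_pos hy, if_pos hy, expSum]
    ring
  · rw [hg]
    ring
  · intro t y ht hty
    simpa only [hζ] using hmax (t, y) ⟨ht, by dsimp only; linarith, hty⟩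
end
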